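/- arXiv:1502.05576 — 3 statements merged into one kernel-verified Lean document; each statement's English description precedes it below -/
import Mathlib

section
/- Let (C_{φ_t})_{t≥0} be an immediately compact semigroup of composition operators on H²(𝔻) or the Dirichlet space 𝒟, and suppose that in the semiflow model φ_t(z) = h^{-1}(e^{-ct}h(z)) the boundary ∂Ω of the associated domain Ω is locally connected. Then the following are equivalent: (1) there exists t₀ > 0 with ‖φ_{t₀}‖_∞ < 1; (2) ‖φ_t‖_∞ < 1 for all t > 0. Consequently, if ‖φ_{t₀}‖_∞ < 1 for some t₀ > 0 then the semigroup is immediately trace-class. -/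
open Complex MeasureTheory Filter Set Metric
open scoped Real Topology ENNReal

noncomputable section

/-- The weighted Hardy space `H²(β)`, modeled as the `ℓ²` space of weighted
Taylor coefficient sequences: the function `f(z) = Σ cₙ zⁿ` corresponds to the
square-summable sequence `(cₙ βₙ)ₙ`. -/
abbrev WH2 : Type := lp (fun _ : ℕ => ℂ) 2

/-- The analytic function on the unit disc associated to an element of `H²(β)`. -/
def wToFun (β : ℕ → ℝ) (f : WH2) (z : ℂ) : ℂ := ∑' n : ℕ, (f n / (β n : ℂ)) * z ^ n

/-- The open unit disc. -/
def uDisc : Set ℂ := Metric.ball 0 1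

/-- Weights of the classical Hardy space `H²(𝔻)` (`βₙ = 1`). -/
def hardyW : ℕ → ℝ := fun _ => 1

/-- Weights of the Dirichlet space `𝒟` (`β₀ = 1`, `βₙ = √n`). -/
def dirichletW : ℕ → ℝ := fun n => if n = 0 then 1 else Real.sqrt n

/-- The monomial `eₙ(z) = zⁿ` as an element of `H²(β)`. -/
def eW (β : ℕ → ℝ) (n : ℕ) : WH2 := lp.single 2 n ((β n : ℝ) : ℂ)

/-- `T` acts as the composition operator with analytic self-map symbol `φ` on `H²(β)`. -/
def RepresentsComp (β : ℕ → ℝ) (T : WH2 →L[ℂ] WH2) (φ : ℂ → ℂ) : Prop :=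
  DifferentiableOn ℂ φ uDisc ∧ MapsTo φ uDisc uDisc ∧
  ∀ f : WH2, ∀ z ∈ uDisc, wToFun β (T f) z = wToFun β f (φ z)

/-- `T` is a composition operator on `H²(β)`. -/
def IsCompositionOperator (β : ℕ → ℝ) (T : WH2 →L[ℂ] WH2) : Prop :=
  ∃ φ : ℂ → ℂ, RepresentsComp β T φ

/-- `T` is a weighted composition operator `f ↦ w · (f ∘ φ)` on `H²(𝔻)`. -/
def IsWeightedCompOp (T : WH2 →L[ℂ] WH2) : Prop :=
  ∃ w φ : ℂ → ℂ, DifferentiableOn ℂ w uDisc ∧ DifferentiableOn ℂ φ uDisc ∧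
    MapsTo φ uDisc uDisc ∧
    ∀ f : WH2, ∀ z ∈ uDisc, wToFun hardyW (T f) z = w z * wToFun hardyW f (φ z)

section Semigroup

variable {X : Type*} [NormedAddCommGroup X] [NormedSpace ℂ X]

/-- `T` is a `C₀`-semigroup (indexed by `t ≥ 0`). -/
def IsC0Semigroup (T : ℝ → X →L[ℂ] X) : Prop :=
  T 0 = 1 ∧ (∀ s t : ℝ, 0 ≤ s → 0 ≤ t → T (s + t) = (T s).comp (T t)) ∧
  ∀ x : X, Tendsto (fun t : ℝ => T t x) (𝓝[≥] 0) (𝓝 x)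

/-- `T` is a `C₀`-group (indexed by `t ∈ ℝ`). -/
def IsC0Group (T : ℝ → X →L[ℂ] X) : Prop :=
  T 0 = 1 ∧ (∀ s t : ℝ, T (s + t) = (T s).comp (T t)) ∧
  ∀ x : X, Tendsto (fun t : ℝ => T t x) (𝓝 0) (𝓝 x)

/-- Quasicontractive: `‖T(t)‖ ≤ e^{wt}` for some `w ≥ 0` and all `t ≥ 0`. -/
def Quasicontractive (T : ℝ → X →L[ℂ] X) : Prop :=
  ∃ w : ℝ, 0 ≤ w ∧ ∀ t : ℝ, 0 ≤ t → ‖T t‖ ≤ Real.exp (w * t)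

/-- The sector `Σ_θ = {re^{iα} : r ≥ 0, |α| < θ}` (note `arg 0 = 0`). -/
def Sector (θ : ℝ) : Set ℂ := {z : ℂ | |Complex.arg z| < θ}

/-- `Te` is an analytic extension of the semigroup `T` to the sector `Σ_θ`,
bounded on `Σ_θ ∩ 𝔻`. -/
def IsAnalyticExtension (T : ℝ → X →L[ℂ] X) (θ : ℝ) (Te : ℂ → X →L[ℂ] X) : Prop :=
  (∀ t : ℝ, 0 ≤ t → Te t = T t) ∧
  DifferentiableOn ℂ Te (Sector θ \ {0}) ∧
  ∃ M : ℝ, ∀ ξ ∈ Sector θ, ‖ξ‖ < 1 → ‖Te ξ‖ ≤ M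

/-- The semigroup `T` extends analytically and boundedly to the sector `Σ_θ`. -/
def HasAnalyticExtension (T : ℝ → X →L[ℂ] X) (θ : ℝ) : Prop :=
  ∃ Te : ℂ → X →L[ℂ] X, IsAnalyticExtension T θ Te

/-- The semigroup `T` is analytic (on some sector `Σ_θ`, `θ ∈ (0, π/2]`). -/
def IsAnalyticSemigroup (T : ℝ → X →L[ℂ] X) : Prop :=
  ∃ θ ∈ Set.Ioc 0 (π / 2), HasAnalyticExtension T θ

/-- `y` is the limit of `(T(t)x - x)/t` as `t → 0⁺`. -/
def GenLimit (T : ℝ → X →L[ℂ] X) (x y : X) : Prop :=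
  Tendsto (fun t : ℝ => (t : ℂ)⁻¹ • (T t x - x)) (𝓝[>] 0) (𝓝 y)

/-- `A`, with domain `D`, is the infinitesimal generator of the semigroup `T`. -/
def IsGenerator (T : ℝ → X →L[ℂ] X) (D : Set X) (A : X → X) : Prop :=
  (∀ x ∈ D, GenLimit T x (A x)) ∧ ∀ x : X, (∃ y, GenLimit T x y) → x ∈ D

/-- `y` is the two-sided limit of `(T(t)x - x)/t` as `t → 0` (for groups). -/
def GenLimitGrp (T : ℝ → X →L[ℂ] X) (x y : X) : Prop :=
  Tendsto (fun t : ℝ => (t : ℂ)⁻¹ • (T t x - x)) (𝓝[≠] 0) (𝓝 y)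

/-- `A`, with domain `D`, is the infinitesimal generator of the group `T`. -/
def IsGeneratorGrp (T : ℝ → X →L[ℂ] X) (D : Set X) (A : X → X) : Prop :=
  (∀ x ∈ D, GenLimitGrp T x (A x)) ∧ ∀ x : X, (∃ y, GenLimitGrp T x y) → x ∈ D

/-- Immediately compact semigroup: `T(t)` is compact for all `t > 0`. -/
def ImmediatelyCompact (T : ℝ → X →L[ℂ] X) : Prop :=
  ∀ t : ℝ, 0 < t → IsCompactOperator (T t)

/-- Eventually compact semigroup: `T(t)` is compact for all `t ≥ t₀`, some `t₀ > 0`. -/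
def EventuallyCompact (T : ℝ → X →L[ℂ] X) : Prop :=
  ∃ t₀ : ℝ, 0 < t₀ ∧ ∀ t : ℝ, t₀ ≤ t → IsCompactOperator (T t)

end Semigroup

/-- The natural domain of the operator `A f = G f'` in `H²(β)`: those `f` for which
`G · (wToFun β f)'` is realized by some element of `H²(β)`. -/
def domA (β : ℕ → ℝ) (G : ℂ → ℂ) : Set WH2 :=
  {f : WH2 | ∃ g : WH2, ∀ z ∈ uDisc, wToFun β g z = G z * deriv (wToFun β f) z}

open Classical in
/-- The operator `A f = G f'` on `H²(β)` (defined via choice on its natural domain). -/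
def opA (β : ℕ → ℝ) (G : ℂ → ℂ) (f : WH2) : WH2 :=
  if h : f ∈ domA β G then h.choose else 0

/-- `(φ_t)_{t ≥ 0}` is a (jointly continuous) semiflow of analytic self-maps of `𝔻`. -/
def IsSemiflow (φ : ℝ → ℂ → ℂ) : Prop :=
  (∀ z ∈ uDisc, φ 0 z = z) ∧
  (∀ t : ℝ, 0 ≤ t → DifferentiableOn ℂ (φ t) uDisc ∧ MapsTo (φ t) uDisc uDisc) ∧
  (∀ s t : ℝ, 0 ≤ s → 0 ≤ t → ∀ z ∈ uDisc, φ (s + t) z = φ s (φ t z)) ∧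
  ContinuousOn (fun p : ℝ × ℂ => φ p.1 p.2) (Set.Ici 0 ×ˢ uDisc)

/-- `G` is the infinitesimal generator of the semiflow `φ`: `∂φ_t/∂t = G ∘ φ_t`. -/
def SemiflowGenerator (φ : ℝ → ℂ → ℂ) (G : ℂ → ℂ) : Prop :=
  ∀ z ∈ uDisc, ∀ t : ℝ, 0 ≤ t → HasDerivAt (fun s : ℝ => φ s z) (G (φ t z)) t

/-- Hilbert–Schmidt operator on `WH2` (w.r.t. the standard orthonormal basis). -/
def IsHilbertSchmidt (T : WH2 →L[ℂ] WH2) : Prop :=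
  Summable (fun n : ℕ => ‖T (lp.single 2 n (1 : ℂ))‖ ^ 2)

/-- Trace-class operator on `WH2`: a product of two Hilbert–Schmidt operators. -/
def IsTraceClass (T : WH2 →L[ℂ] WH2) : Prop :=
  ∃ A B : WH2 →L[ℂ] WH2, IsHilbertSchmidt A ∧ IsHilbertSchmidt B ∧ T = A.comp B

/-- `‖φ‖_∞ < 1` for a function on the unit disc. -/
def SupNormLtOne (φ : ℂ → ℂ) : Prop :=
  ∃ r : ℝ, r < 1 ∧ ∀ z ∈ uDisc, ‖φ z‖ ≤ r

/-- Essential boundary condition via radial limits: for almost every boundary point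
`ξ = e^{it}`, whenever the radial limit `L` of `G` at `ξ` exists,
`Re (e^{iα} ξ̄ L) ≤ c`.  (This encodes `ess sup_(z ∈ 𝕋) Re (e^{iα} z̄ G(z)) ≤ c`.) -/
def BoundaryReLe (G : ℂ → ℂ) (α : ℝ) (c : ℝ) : Prop :=
  ∀ᵐ t : ℝ, ∀ L : ℂ,
    Tendsto (fun r : ℝ => G ((r : ℂ) * Complex.exp ((t : ℂ) * Complex.I)))
      (𝓝[<] 1) (𝓝 L) →
    (Complex.exp ((α : ℂ) * Complex.I) *
      (starRingEnd ℂ) (Complex.exp ((t : ℂ) * Complex.I)) * L).re ≤ c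

/-- `Re (z̄ G(z)) = 0` almost everywhere on the unit circle, via radial limits. -/
def BoundaryReEqZero (G : ℂ → ℂ) : Prop :=
  ∀ᵐ t : ℝ, ∀ L : ℂ,
    Tendsto (fun r : ℝ => G ((r : ℂ) * Complex.exp ((t : ℂ) * Complex.I)))
      (𝓝[<] 1) (𝓝 L) →
    ((starRingEnd ℂ) (Complex.exp ((t : ℂ) * Complex.I)) * L).re = 0

end

/-- Maximum modulus principle on a closed rectangle `[-1, 1] × [a, b]`. -/
lemma norm_le_of_rect_boundary {F : ℂ → ℂ} {a b C : ℝ} (hab : a < b)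
    (hF : DifferentiableOn ℂ F (Icc (-1) 1 ×ℂ Icc a b))
    (hC : ∀ x ∈ Icc (-1 : ℝ) 1, ∀ y ∈ Icc a b, x = -1 ∨ x = 1 ∨ y = a ∨ y = b →
      ‖F (x + y * I)‖ ≤ C)
    {x y : ℝ} (hx : x ∈ Icc (-1 : ℝ) 1) (hy : y ∈ Icc a b) : ‖F (x + y * I)‖ ≤ C := by
  have hcl : closure (Ioo (-1 : ℝ) 1 ×ℂ Ioo a b) = Icc (-1) 1 ×ℂ Icc a b := by
    rw [closure_reProdIm, closure_Ioo (by norm_num), closure_Ioo hab.ne]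
  have hbd : Bornology.IsBounded (Ioo (-1 : ℝ) 1 ×ℂ Ioo a b) :=
    (isBounded_Ioo (-1 : ℝ) 1).reProdIm (isBounded_Ioo a b)
  have hopen : IsOpen (Ioo (-1 : ℝ) 1 ×ℂ Ioo a b) := isOpen_Ioo.reProdIm isOpen_Ioo
  refine norm_le_of_forall_mem_frontier_norm_le hbd
    (DifferentiableOn.diffContOnCl (by rwa [hcl])) ?_ (z := x + y * I) ?_
  · intro z hz
    rw [hopen.frontier_eq, hcl] at hz
    obtain ⟨⟨h1, h2⟩, h3⟩ := hz
    have := hC z.re h1 z.im h2 (by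
      by_contra hcon
      push Not at hcon
      exact h3 ⟨⟨lt_of_le_of_ne h1.1 (Ne.symm hcon.1), lt_of_le_of_ne h1.2 hcon.2.1⟩,
        ⟨lt_of_le_of_ne h2.1 (Ne.symm hcon.2.2.1), lt_of_le_of_ne h2.2 hcon.2.2.2⟩⟩)
    rwa [re_add_im] at this
  · rw [hcl]
    simpa [mem_reProdIm] using ⟨hx, hy⟩

/-- A nonvanishing bounded holomorphic function on a rectangle whose modulus tends to `1` at the
bottom side does so at least linearly along the vertical axis. -/
lemma exists_one_sub_norm_le_mul {k : ℂ → ℂ}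
    (hk : DifferentiableOn ℂ k (Icc (-1) 1 ×ℂ Ioc 0 1))
    (hk0 : ∀ z ∈ Icc (-1 : ℝ) 1 ×ℂ Ioc 0 1, k z ≠ 0)
    (hbot : ∀ ε > 0, ∃ η > 0, ∀ z ∈ Icc (-1 : ℝ) 1 ×ℂ Ioc 0 1, z.im < η → 1 - ε < ‖k z‖) :
    ∃ C : ℝ, 0 < C ∧ ∀ y ∈ Ioc (0 : ℝ) 1, 1 - ‖k (y * I)‖ ≤ C * y := by
  have hsub : ∀ a : ℝ, 0 < a → Icc (-1 : ℝ) 1 ×ℂ Icc a 1 ⊆ Icc (-1 : ℝ) 1 ×ℂ Ioc 0 1 :=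
    fun a ha z hz => ⟨hz.1, lt_of_lt_of_le ha hz.2.1, hz.2.2⟩
  obtain ⟨M, hM0, hM⟩ : ∃ M : ℝ, 0 < M ∧ ∀ z ∈ Icc (-1 : ℝ) 1 ×ℂ Ioc 0 1,
      ‖k z‖⁻¹ ≤ Real.exp M := by
    obtain ⟨η, hη, hη'⟩ := hbot (1 / 2) (by norm_num)
    have hcpt : IsCompact (Icc (-1 : ℝ) 1 ×ℂ Icc η 1) := isCompact_Icc.reProdIm isCompact_Icc
    have hcont : ContinuousOn (fun z => ‖k z‖⁻¹) (Icc (-1 : ℝ) 1 ×ℂ Icc η 1) :=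
      ((hk.continuousOn.mono (hsub η hη)).norm).inv₀
        (fun z hz => norm_ne_zero_iff.2 (hk0 z (hsub η hη hz)))
    obtain ⟨B, hB⟩ := hcpt.bddAbove_image hcont
    refine ⟨max B 2, lt_max_of_lt_right two_pos, fun z hz => ?_⟩
    have hexp : max B 2 ≤ Real.exp (max B 2) := by
      linarith [Real.add_one_le_exp (max B 2)]
    refine le_trans ?_ hexp
    rcases lt_or_ge z.im η with h | h
    · refine le_max_of_le_right ?_
      have := hη' z hz h
      rw [inv_le_comm₀ (by linarith) two_pos]
      linarith
    · exact le_max_of_le_left (hB ⟨z, ⟨hz.1, h, hz.2.2⟩, rfl⟩)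
  refine ⟨2 * M, by positivity, fun y hy => ?_⟩
  suffices h : Real.exp (-(2 * M * y)) ≤ ‖k (y * I)‖ by
    linarith [Real.add_one_le_exp (-(2 * M * y))]
  have hyR : (y * I : ℂ) ∈ Icc (-1 : ℝ) 1 ×ℂ Ioc 0 1 := by
    simpa [mem_reProdIm] using hy
  have key : ∀ ε ∈ Ioo (0 : ℝ) 1, (1 - ε) * Real.exp (-(2 * M * y)) ≤ ‖k (y * I)‖ := by
    intro ε hε
    obtain ⟨η, hη, hη'⟩ := hbot ε hε.1
    set a : ℝ := min (η / 2) (y / 2) with ha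
    have ha0 : 0 < a := lt_min (by linarith) (by linarith [hy.1])
    have haη : a < η := (min_le_left _ _).trans_lt (by linarith)
    have hay : a < y := (min_le_right _ _).trans_lt (by linarith [hy.1])
    have hnorm : ∀ u v : ℝ, ‖(k (u + v * I))⁻¹ *
        Complex.exp (-(M : ℂ) * ((u + v * I) ^ 2 - 2 * I * (u + v * I)))‖ =
        ‖k (u + v * I)‖⁻¹ * Real.exp (-M * (u ^ 2 - v ^ 2 + 2 * v)) := by
      intro u v
      rw [norm_mul, norm_inv, Complex.norm_exp]
      congr 2
      simp [pow_two]
    have hmax := norm_le_of_rect_boundary (C := (1 - ε)⁻¹) (x := 0) (y := y) (a := a) (b := 1)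
      (F := fun w => (k w)⁻¹ * Complex.exp (-(M : ℂ) * (w ^ 2 - 2 * I * w)))
      (lt_of_lt_of_le hay hy.2)
      (((hk.mono (hsub a ha0)).inv (fun z hz => hk0 z (hsub a ha0 hz))).mul
        (by fun_prop)) ?_ (by simp) ⟨hay.le, hy.2⟩
    · rw [hnorm] at hmax
      simp only [ofReal_zero, zero_add] at hmax
      have hkpos : 0 < ‖k (y * I)‖ := norm_pos_iff.2 (hk0 _ hyR)
      have h1e : 0 < 1 - ε := by linarith [hε.2]
      have hle : Real.exp (-(2 * M * y)) ≤ Real.exp (-M * (0 ^ 2 - y ^ 2 + 2 * y)) := by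
        apply Real.exp_le_exp.2
        nlinarith [sq_nonneg y]
      have h2 : ‖k (y * I)‖⁻¹ * Real.exp (-(2 * M * y)) ≤ (1 - ε)⁻¹ :=
        (mul_le_mul_of_nonneg_left hle (by positivity)).trans hmax
      rw [inv_mul_le_iff₀ hkpos, ← div_eq_mul_inv, le_div_iff₀ h1e] at h2
      linarith
    · intro u hu v hv hbd
      rw [hnorm]
      have hmem : (u + v * I : ℂ) ∈ Icc (-1 : ℝ) 1 ×ℂ Ioc 0 1 := by
        simpa [mem_reProdIm] using ⟨hu, lt_of_lt_of_le ha0 hv.1, hv.2⟩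
      have h1e : 1 ≤ (1 - ε)⁻¹ := (one_le_inv₀ (by linarith [hε.2])).2 (by linarith [hε.1])
      have hv0 : 0 < v := lt_of_lt_of_le ha0 hv.1
      have hside : 1 ≤ u ^ 2 - v ^ 2 + 2 * v → ‖k (u + v * I)‖⁻¹ *
          Real.exp (-M * (u ^ 2 - v ^ 2 + 2 * v)) ≤ (1 - ε)⁻¹ := by
        intro h
        refine le_trans (mul_le_mul (hM _ hmem) (Real.exp_le_exp.2 (?_ : _ ≤ -M))
          (by positivity) (by positivity)) ?_
        · nlinarith
        · rw [← Real.exp_add]; simpa using h1e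
      rcases hbd with h | h | h | h
      · exact hside (by subst h; nlinarith [hv.2])
      · exact hside (by subst h; nlinarith [hv.2])
      · have := hη' _ hmem (by simpa [h] using haη)
        refine (mul_le_mul (inv_anti₀ (by linarith [hε.2]) this.le)
          (Real.exp_le_one_iff.2 ?_) (by positivity) (by linarith)).trans (by rw [mul_one])
        have : 0 ≤ u ^ 2 - v ^ 2 + 2 * v := by nlinarith [hv.2, sq_nonneg u]
        nlinarith
      · exact hside (by subst h; nlinarith [sq_nonneg u])
  have hlim : Tendsto (fun ε : ℝ => (1 - ε) * Real.exp (-(2 * M * y))) (𝓝[>] 0)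
      (𝓝 ((1 - 0) * Real.exp (-(2 * M * y)))) := by
    apply Tendsto.mono_left _ nhdsWithin_le_nhds
    exact Continuous.tendsto (by fun_prop) 0
  rw [sub_zero, one_mul] at hlim
  refine le_of_tendsto hlim ?_
  filter_upwards [Ioo_mem_nhdsGT (zero_lt_one (α := ℝ))] with ε hε using key ε hε

/-- Hopf-type lemma: a holomorphic function into the disc on a rectangle stays at least linearly
far from the unit circle along the vertical axis. -/
lemma exists_mul_le_one_sub_norm {k : ℂ → ℂ}
    (hk : DifferentiableOn ℂ k (Icc (-1) 1 ×ℂ Ioc 0 1))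
    (hk1 : ∀ z ∈ Icc (-1 : ℝ) 1 ×ℂ Ioc 0 1, ‖k z‖ < 1) :
    ∃ m : ℝ, 0 < m ∧ ∀ y ∈ Ioc (0 : ℝ) (1 / 2), m * y ≤ 1 - ‖k (y * I)‖ := by
  obtain ⟨m, hm0, hm⟩ : ∃ m : ℝ, 0 < m ∧ ∀ u ∈ Icc (-1 : ℝ) 1,
      ‖k (u + (1 / 2 : ℝ) * I)‖ ≤ Real.exp (-m) := by
    have hmaps : ∀ u ∈ Icc (-1 : ℝ) 1,
        (u + (1 / 2 : ℝ) * I : ℂ) ∈ Icc (-1 : ℝ) 1 ×ℂ Ioc 0 1 := by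
      intro u hu
      rw [mem_reProdIm]
      simpa using ⟨hu, by norm_num⟩
    have hcont : ContinuousOn (fun u : ℝ => ‖k (u + (1 / 2 : ℝ) * I)‖) (Icc (-1 : ℝ) 1) :=
      (hk.continuousOn.comp (by fun_prop) hmaps).norm
    obtain ⟨u₀, hu₀, hmax⟩ := isCompact_Icc.exists_isMaxOn ⟨0, by simp⟩ hcont
    have hlt := hk1 _ (hmaps u₀ hu₀)
    refine ⟨1 - ‖k (u₀ + (1 / 2 : ℝ) * I)‖, by linarith, fun u hu => ?_⟩
    have h1 := hmax hu
    simp only [mem_ofPred_eq] at h1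
    refine h1.trans ?_
    linarith [Real.add_one_le_exp (-(1 - ‖k (u₀ + (1 / 2 : ℝ) * I)‖))]
  refine ⟨(m / 2) / (1 + m / 2), by positivity, fun y hy => ?_⟩
  have hy0 := hy.1
  have hnorm : ∀ u v : ℝ, ‖k (u + v * I) *
      Complex.exp ((m : ℂ) * (-I * (u + v * I) - (u + v * I) ^ 2))‖ =
      ‖k (u + v * I)‖ * Real.exp (m * (v + v ^ 2 - u ^ 2)) := by
    intro u v
    rw [norm_mul, Complex.norm_exp]
    congr 2
    simp only [mul_re, ofReal_re, ofReal_im, sub_re, add_re, neg_re, I_re, I_im, neg_im, pow_two,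
      add_im, mul_im]
    ring
  have hsub : Icc (-1 : ℝ) 1 ×ℂ Icc (y / 2) (1 / 2) ⊆ Icc (-1 : ℝ) 1 ×ℂ Ioc 0 1 :=
    fun z hz => ⟨hz.1, lt_of_lt_of_le (by linarith) hz.2.1, hz.2.2.trans (by norm_num)⟩
  have hmax := norm_le_of_rect_boundary (C := Real.exp (m * (y / 2 + (y / 2) ^ 2)))
    (x := 0) (y := y) (a := y / 2) (b := 1 / 2)
    (F := fun w => k w * Complex.exp ((m : ℂ) * (-I * w - w ^ 2)))
    (by linarith [hy.2]) ((hk.mono hsub).mul (by fun_prop)) ?_ (by simp)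
    ⟨by linarith, hy.2⟩
  · rw [hnorm] at hmax
    simp only [ofReal_zero, zero_add] at hmax
    rw [← le_div_iff₀ (Real.exp_pos _), ← Real.exp_sub] at hmax
    have h1 : Real.exp (m * (y / 2 + (y / 2) ^ 2) - m * (y + y ^ 2 - 0 ^ 2)) ≤
        Real.exp (-(m / 2 * y)) := by
      apply Real.exp_le_exp.2
      nlinarith [mul_pos hm0 (pow_pos hy0 2)]
    have h2 : Real.exp (-(m / 2 * y)) ≤ (1 + m / 2 * y)⁻¹ := by
      rw [Real.exp_neg]
      exact inv_anti₀ (by positivity) (by linarith [Real.add_one_le_exp (m / 2 * y)])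
    have h3 : (m / 2) / (1 + m / 2) * y ≤ 1 - (1 + m / 2 * y)⁻¹ := by
      have hy1 : y ≤ 1 := hy.2.trans (by norm_num)
      have : 1 - (1 + m / 2 * y)⁻¹ = (m / 2 * y) / (1 + m / 2 * y) := by
        field_simp; ring
      rw [this, div_mul_eq_mul_div]
      exact div_le_div_of_nonneg_left (by positivity) (by positivity) (by nlinarith)
    linarith
  · intro u hu v hv hbd
    rw [hnorm]
    have hv0 : 0 < v := lt_of_lt_of_le (by linarith) hv.1
    have hmem : (u + v * I : ℂ) ∈ Icc (-1 : ℝ) 1 ×ℂ Ioc 0 1 := by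
      rw [mem_reProdIm]
      simpa using ⟨hu, hv0, hv.2.trans (by norm_num)⟩
    have hlt := (hk1 _ hmem).le
    have hside : v + v ^ 2 - u ^ 2 ≤ y / 2 + (y / 2) ^ 2 → ‖k (u + v * I)‖ *
        Real.exp (m * (v + v ^ 2 - u ^ 2)) ≤ Real.exp (m * (y / 2 + (y / 2) ^ 2)) := fun h =>
      (mul_le_of_le_one_left (by positivity) hlt).trans
        (Real.exp_le_exp.2 (mul_le_mul_of_nonneg_left h hm0.le))
    rcases hbd with h | h | h | h
    · exact hside (by subst h; nlinarith [hv.2, sq_nonneg y])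
    · exact hside (by subst h; nlinarith [hv.2, sq_nonneg y])
    · exact hside (by subst h; nlinarith [sq_nonneg u])
    · subst h
      refine (mul_le_mul_of_nonneg_right (hm u hu) (by positivity)).trans ?_
      rw [← Real.exp_add]
      apply Real.exp_le_exp.2
      have : 0 ≤ m * (y / 2 + (y / 2) ^ 2) := by positivity
      nlinarith [mul_nonneg hm0.le (sq_nonneg u)]

/-- An injective holomorphic function on the disc has a holomorphic inverse on its (open) image. -/
lemma exists_holomorphic_inverse {h : ℂ → ℂ} (hh : DifferentiableOn ℂ h uDisc)
    (hinj : InjOn h uDisc) :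
    ∃ g : ℂ → ℂ, DifferentiableOn ℂ g (h '' uDisc) ∧ ∀ z ∈ uDisc, g (h z) = z := by
  have hD : IsOpen uDisc := isOpen_ball
  have han : AnalyticOnNhd ℂ h uDisc := hh.analyticOnNhd hD
  have hopen : ∀ s ⊆ uDisc, IsOpen s → IsOpen (h '' s) := by
    rcases han.is_constant_or_isOpen (convex_ball _ _).isPreconnected with ⟨w, hw⟩ | h'
    · exfalso
      have h0 : (0 : ℂ) ∈ uDisc := by simp [uDisc]
      have h1 : (1 / 2 : ℂ) ∈ uDisc := by simp [uDisc]; norm_num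
      have := hinj h0 h1 ((hw 0 h0).trans (hw _ h1).symm)
      norm_num at this
    · exact h'
  have hg : ∀ z ∈ uDisc, Function.invFunOn h uDisc (h z) = z := fun z hz =>
    hinj.leftInvOn_invFunOn hz
  refine ⟨Function.invFunOn h uDisc, ?_, hg⟩
  set g := Function.invFunOn h uDisc with hgdef
  have hcont : ∀ z ∈ uDisc, ContinuousAt g (h z) := by
    intro z hz
    rw [ContinuousAt, hg z hz]
    intro V hV
    obtain ⟨W, hWV, hWo, hzW⟩ := _root_.mem_nhds_iff.1 hV
    refine mem_map.2 (mem_of_superset ((hopen (W ∩ uDisc) inter_subset_right (hWo.inter hD)).mem_nhds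
      ⟨z, ⟨hzW, hz⟩, rfl⟩) ?_)
    rintro _ ⟨x, hx, rfl⟩
    change g (h x) ∈ V
    rw [hg x hx.2]
    exact hWV hx.1
  have hΩ : IsOpen (h '' uDisc) := hopen _ Subset.rfl hD
  have hright : ∀ w ∈ h '' uDisc, h (g w) = w := by
    rintro _ ⟨z, hz, rfl⟩
    rw [hg z hz]
  have hdiff : ∀ z ∈ uDisc, deriv h z ≠ 0 → DifferentiableAt ℂ g (h z) := by
    intro z hz hne
    have hd : HasDerivAt h (deriv h z) (g (h z)) := by
      rw [hg z hz]
      exact (hh.differentiableAt (hD.mem_nhds hz)).hasDerivAt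
    exact (HasDerivAt.of_local_left_inverse (hcont z hz) hd hne
      (by filter_upwards [hΩ.mem_nhds ⟨z, hz, rfl⟩] with w hw using hright w hw)).differentiableAt
  rintro _ ⟨z, hz, rfl⟩
  refine (analyticAt_of_differentiable_on_punctured_nhds_of_continuousAt ?_
    (hcont z hz)).differentiableAt.differentiableWithinAt
  have hderiv : ∀ᶠ x in 𝓝[≠] z, deriv h x ≠ 0 := by
    refine (han z hz).deriv.eventually_eq_zero_or_eventually_ne_zero.resolve_left fun hev => ?_
    obtain ⟨r, hr, hball⟩ := Metric.eventually_nhds_iff_ball.1 (hev.and (hD.mem_nhds hz))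
    have hx : z + (r / 2 : ℝ) ∈ ball z r := by
      rw [mem_ball_iff_norm, add_sub_cancel_left, norm_real, Real.norm_of_nonneg (by positivity)]
      linarith
    have := hinj (hball _ hx).2 hz (isOpen_ball.is_const_of_deriv_eq_zero
      (convex_ball z r).isPreconnected (hh.mono fun x hx => (hball x hx).2)
      (fun x hx => (hball x hx).1) hx (mem_ball_self hr))
    simp [hr.ne'] at this
  have htend : Tendsto g (𝓝[≠] (h z)) (𝓝 z) := by
    have := (hcont z hz).tendsto
    rw [hg z hz] at this
    exact this.mono_left nhdsWithin_le_nhds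
  rw [eventually_nhdsWithin_iff] at hderiv
  filter_upwards [htend.eventually hderiv, self_mem_nhdsWithin,
    mem_nhdsWithin_of_mem_nhds (hΩ.mem_nhds ⟨z, hz, rfl⟩)] with w h1 h2 h3
  obtain ⟨x, hx, rfl⟩ := h3
  rw [hg x hx] at h1
  exact hdiff x hx (h1 (by rintro rfl; exact h2 rfl))

/-- A preconnected set meeting an open set and its complement meets the frontier. -/
lemma exists_mem_frontier_of_isPreconnected {α : Type*} [TopologicalSpace α] {s t : Set α}
    (hs : IsOpen s) (ht : IsPreconnected t) {a b : α} (ha : a ∈ t) (has : a ∈ s)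
    (hb : b ∈ t) (hbs : b ∉ s) : ∃ x ∈ t, x ∈ frontier s := by
  by_contra! hcon
  have hcl : ∀ x ∈ t, x ∉ s → x ∈ (closure s)ᶜ := fun x hx hxs hxc =>
    hcon x hx (hs.frontier_eq ▸ ⟨hxc, hxs⟩)
  obtain ⟨x, -, hx⟩ := ht s (closure s)ᶜ hs isClosed_closure.isOpen_compl
    (fun x hx => (em (x ∈ s)).imp_right (hcl x hx)) ⟨a, ha, has⟩ ⟨b, hb, hcl b hb hbs⟩
  exact hx.2 (subset_closure hx.1)

/-- If the boundary of `Ω` is locally connected at `E x₁`, where `E x = w e^{c x}` parametrizes a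
trajectory of the backward flow lying in `∂Ω` and accessible from the side `σ`, then a whole
one-sided neighbourhood of the trajectory lies in `Ω`. -/
lemma exists_strip_subset {Ω : Set ℂ} (hΩ : IsOpen Ω)
    (hlc : LocallyConnectedSpace (frontier Ω))
    {c w : ℂ} (hc : c ≠ 0) (hw : w ≠ 0)
    (hspiral : ∀ v ∈ Ω, ∀ t : ℝ, 0 ≤ t → Complex.exp (-(c * (t : ℂ))) * v ∈ Ω)
    {x₁ ε₀ : ℝ} (hx₁ : w * Complex.exp (c * x₁) ∈ frontier Ω) {σ : ℝ} (hσ : σ = 1 ∨ σ = -1)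
    (hacc : ∀ ε > 0, ∃ x y : ℝ, x₁ + ε₀ < x ∧ 0 < y ∧ y < ε ∧
      w * Complex.exp (c * (x + σ * y * I)) ∈ Ω) (hε₀ : 0 < ε₀) :
    ∃ δ > 0, ∀ x y : ℝ, x ≤ x₁ → 0 < y → y < δ →
      w * Complex.exp (c * (x + σ * y * I)) ∈ Ω := by
  set E : ℂ → ℂ := fun ζ => w * Complex.exp (c * ζ) with hE
  have hflow : ∀ (ζ : ℂ) (s : ℝ), 0 ≤ s → E ζ ∈ Ω → E (ζ - s) ∈ Ω := by
    intro ζ s hs hζ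
    convert hspiral _ hζ s hs using 1
    simp only [hE]
    rw [mul_left_comm, ← Complex.exp_add]
    ring_nf
  have hEc : Continuous E := by fun_prop
  set p := E x₁ with hp
  have hp0 : p ≠ 0 := mul_ne_zero hw (Complex.exp_ne_zero _)
  set Lg : ℂ → ℂ := fun v => x₁ + Complex.log (v / p) / c with hLg
  have hLgc : ContinuousAt Lg p := by
    refine continuousAt_const.add (ContinuousAt.div_const (ContinuousAt.clog (continuousAt_id.div_const p) ?_) _)
    simp [hp0]
  have hLgp : Lg p = x₁ := by simp [hLg, hp0]
  have hELg : ∀ v ≠ 0, E (Lg v) = v := by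
    intro v hv
    have : E (Lg v) = p * Complex.exp (Complex.log (v / p)) := by
      simp only [hE, hLg, hp]
      rw [mul_assoc, ← Complex.exp_add]
      congr 2
      field_simp
    rw [this, Complex.exp_log (div_ne_zero hv hp0)]
    field_simp
  have hLgE : ∀ᶠ ζ in 𝓝 (x₁ : ℂ), Lg (E ζ) = ζ := by
    have h1 : ∀ᶠ ζ in 𝓝 (x₁ : ℂ), (c * (ζ - x₁)).im ∈ Ioo (-π) π := by
      refine ContinuousAt.eventually_mem (by fun_prop) (Ioo_mem_nhds ?_ ?_) <;>
        simp [Real.pi_pos]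
    filter_upwards [h1] with ζ hζ
    have : E ζ / p = Complex.exp (c * (ζ - x₁)) := by
      rw [div_eq_iff hp0]
      simp only [hE, hp]
      rw [mul_left_comm, ← Complex.exp_add]
      ring_nf
    simp only [hLg]
    rw [this, Complex.log_exp hζ.1 hζ.2.le]
    field_simp
    ring
  -- a connected neighbourhood of `p` in the boundary on which `Lg` is close to `x₁`
  have hgood : ∀ᶠ v in 𝓝 p, v ≠ 0 ∧ ContinuousAt Lg v ∧ Lg v ∈ ball (x₁ : ℂ) ε₀ := by
    have h1 : ∀ᶠ v in 𝓝 p, v / p ∈ slitPlane :=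
      ContinuousAt.eventually_mem (continuousAt_id.div_const p) (isOpen_slitPlane.mem_nhds (by simp [hp0]))
    have h2 : ∀ᶠ v in 𝓝 p, Lg v ∈ ball (x₁ : ℂ) ε₀ :=
      hLgc.eventually_mem (by rw [hLgp]; exact ball_mem_nhds _ hε₀)
    filter_upwards [h1, h2, isOpen_ne.mem_nhds hp0] with v hv1 hv2 hv3
    exact ⟨hv3, continuousAt_const.add
      (ContinuousAt.div_const (ContinuousAt.clog (continuousAt_id.div_const p) hv1) _), hv2⟩
  obtain ⟨V, ⟨hVn, hVp⟩, hVsub⟩ := (locallyConnectedSpace_iff_connected_basis.1 hlc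
    (⟨p, hx₁⟩ : frontier Ω)).mem_iff.1 (continuous_subtype_val.continuousAt.eventually hgood)
  obtain ⟨u, hu, huV⟩ := mem_nhds_subtype _ _ _ |>.1 hVn
  set W : Set ℂ := Lg '' (Subtype.val '' V) with hW
  have hWgood : ∀ ζ ∈ W, E ζ ∉ Ω ∧ ζ ∈ ball (x₁ : ℂ) ε₀ := by
    rintro _ ⟨_, ⟨v, hv, rfl⟩, rfl⟩
    have := hVsub hv
    refine ⟨?_, this.2.2⟩
    rw [hELg _ this.1]
    exact fun hmem => hΩ.inter_frontier_eq.subset ⟨hmem, v.2⟩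
  have hWp : IsPreconnected W := by
    refine (hVp.image _ continuous_subtype_val.continuousOn).image _ ?_
    rintro _ ⟨v, hv, rfl⟩
    exact (hVsub hv).2.1.continuousWithinAt
  have hnear : ∀ᶠ ζ in 𝓝 (x₁ : ℂ), E ζ ∈ frontier Ω → ζ ∈ W := by
    filter_upwards [hLgE, hEc.continuousAt.eventually hu] with ζ h1 h2 h3
    exact ⟨E ζ, ⟨⟨E ζ, h3⟩, huV h2, rfl⟩, h1⟩
  obtain ⟨ρ, hρ, hball⟩ := Metric.eventually_nhds_iff_ball.1 hnear
  have hσ2 : σ * σ = 1 := by rcases hσ with h | h <;> norm_num [h]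
  by_contra! hcon
  obtain ⟨x, y₁, hx, hy₁, hy₁ρ, hout⟩ := hcon ρ hρ
  have hout' : E (x₁ + σ * y₁ * I) ∉ Ω := fun hmem => by
    have := hflow _ (x₁ - x) (by linarith) hmem
    refine hout ?_
    convert this using 4
    push_cast
    ring
  obtain ⟨x₂, y₂, hx₂, hy₂, hy₂₁, hin⟩ := hacc y₁ hy₁
  have hin' : ∀ x : ℝ, x ≤ x₂ → E (x + σ * y₂ * I) ∈ Ω := fun x hx => by
    have := hflow _ (x₂ - x) (by linarith) hin
    convert this using 2
    push_cast
    ring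
  obtain ⟨_, ⟨y₃, hy₃, rfl⟩, hfr⟩ :=
    exists_mem_frontier_of_isPreconnected hΩ
      (isPreconnected_Icc.image (f := fun y : ℝ => E (x₁ + σ * y * I)) (s := Icc y₂ y₁)
        (Continuous.continuousOn (by fun_prop)))
      ⟨y₂, ⟨le_rfl, hy₂₁.le⟩, rfl⟩ (hin' x₁ (by linarith))
      ⟨y₁, ⟨hy₂₁.le, le_rfl⟩, rfl⟩ hout'
  have hσn : ‖(σ : ℂ)‖ = 1 := by rcases hσ with h | h <;> simp [h]
  have hζ₃ : (x₁ + σ * y₃ * I : ℂ) ∈ W := by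
    refine hball _ ?_ hfr
    rw [mem_ball_iff_norm, add_sub_cancel_left, norm_mul, norm_mul, hσn, norm_I, norm_real,
      Real.norm_of_nonneg (hy₂.le.trans hy₃.1)]
    linarith [hy₃.2]
  have hζ₁ : (x₁ : ℂ) ∈ W := hball _ (mem_ball_self hρ) hx₁
  obtain ⟨ζ, hζW, hζ⟩ := hWp.intermediate_value hζ₁ hζ₃ (f := fun ζ => σ * ζ.im)
    (Continuous.continuousOn (by fun_prop))
    (show y₂ ∈ _ by simpa [← mul_assoc, hσ2] using ⟨hy₂.le, hy₃.1⟩)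
  obtain ⟨h1, h2⟩ := hWgood ζ hζW
  refine h1 ?_
  have hre : ζ.re ≤ x₂ := by
    have := (abs_re_le_norm (ζ - x₁)).trans_lt (mem_ball_iff_norm.1 h2)
    rw [sub_re, ofReal_re] at this
    linarith [le_abs_self (ζ.re - x₁)]
  convert hin' ζ.re hre using 2
  have : ζ.im = σ * y₂ := by rw [← hζ, ← mul_assoc, hσ2, one_mul]
  conv_lhs => rw [← re_add_im ζ, this]
  push_cast
  ring

lemma WH2.hasSum_norm_sq (f : WH2) : HasSum (fun n => ‖f n‖ ^ 2) (‖f‖ ^ 2) := by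
  have := lp.hasSum_norm (p := 2) (by norm_num) f
  simpa using this

lemma one_le_weight {β : ℕ → ℝ} (hβ : β = hardyW ∨ β = dirichletW) (n : ℕ) : 1 ≤ β n := by
  rcases hβ with rfl | rfl
  · exact le_rfl
  · by_cases hn : n = 0
    · simp [dirichletW, hn]
    · simpa [dirichletW, hn] using Nat.one_le_iff_ne_zero.2 hn

/-- Reproducing kernels of `H²(β)`. -/
lemma exists_kernel {β : ℕ → ℝ} (hβ : ∀ n, 1 ≤ β n) :
    ∃ k : ℂ → WH2, ∀ z ∈ uDisc, ∀ n, k z n = (starRingEnd ℂ z) ^ n / β n := by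
  have : ∀ z : ℂ, ∃ k : WH2, z ∈ uDisc → ∀ n, k n = (starRingEnd ℂ z) ^ n / β n := by
    intro z
    by_cases hz : z ∈ uDisc
    · have hz1 : ‖z‖ < 1 := mem_ball_zero_iff.1 hz
      have hmem : Memℓp (fun n => (starRingEnd ℂ z) ^ n / (β n : ℂ)) 2 := by
        apply memℓp_gen
        refine Summable.of_nonneg_of_le (fun n => by positivity) (fun n => ?_)
          (summable_geometric_of_lt_one (r := ‖z‖ ^ 2) (by positivity)
            (by nlinarith [norm_nonneg z]))
        have h0 : 0 < β n := zero_lt_one.trans_le (hβ n)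
        simp only [norm_div, norm_pow, RCLike.norm_conj, norm_real, Real.norm_of_nonneg h0.le,
          ENNReal.toReal_ofNat, Real.rpow_ofNat]
        rw [← pow_mul, mul_comm 2 n, pow_mul]
        exact pow_le_pow_left₀ (by positivity) (div_le_self (by positivity) (hβ n)) 2
      exact ⟨⟨_, hmem⟩, fun _ n => rfl⟩
    · exact ⟨0, fun h => absurd h hz⟩
  choose k hk using this
  exact ⟨k, hk⟩

section Kernel

variable {β : ℕ → ℝ} {k : ℂ → WH2}

lemma inner_kernel (hk : ∀ z ∈ uDisc, ∀ n, k z n = (starRingEnd ℂ z) ^ n / β n) (f : WH2)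
    {z : ℂ} (hz : z ∈ uDisc) : inner ℂ (k z) f = wToFun β f z := by
  rw [lp.inner_eq_tsum, wToFun]
  refine tsum_congr fun n => ?_
  rw [hk z hz, RCLike.inner_apply]
  simp
  ring

lemma hasSum_norm_kernel_sq (hk : ∀ z ∈ uDisc, ∀ n, k z n = (starRingEnd ℂ z) ^ n / β n)
    {z : ℂ} (hz : z ∈ uDisc) :
    HasSum (fun n => (‖z‖ ^ 2) ^ n / β n ^ 2) (‖k z‖ ^ 2) := by
  convert WH2.hasSum_norm_sq (k z) using 2 with n
  rw [hk z hz, norm_div, norm_pow, RCLike.norm_conj, norm_real, div_pow, Real.norm_eq_abs, sq_abs,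
    ← pow_mul, ← pow_mul, mul_comm]

lemma norm_kernel_sq_hardy (hk : ∀ z ∈ uDisc, ∀ n, k z n = (starRingEnd ℂ z) ^ n / hardyW n)
    {z : ℂ} (hz : z ∈ uDisc) : ‖k z‖ ^ 2 = (1 - ‖z‖ ^ 2)⁻¹ := by
  have hz1 : ‖z‖ < 1 := mem_ball_zero_iff.1 hz
  refine (hasSum_norm_kernel_sq hk hz).unique ?_
  simpa [hardyW] using hasSum_geometric_of_lt_one (r := ‖z‖ ^ 2) (by positivity)
    (by nlinarith [norm_nonneg z])

lemma norm_kernel_sq_dirichlet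
    (hk : ∀ z ∈ uDisc, ∀ n, k z n = (starRingEnd ℂ z) ^ n / dirichletW n)
    {z : ℂ} (hz : z ∈ uDisc) : ‖k z‖ ^ 2 = 1 - Real.log (1 - ‖z‖ ^ 2) := by
  have hz1 : ‖z‖ < 1 := mem_ball_zero_iff.1 hz
  have h1 : |‖z‖ ^ 2| < 1 := by rw [abs_of_nonneg (by positivity)]; nlinarith [norm_nonneg z]
  refine (hasSum_norm_kernel_sq hk hz).unique ?_
  rw [← hasSum_nat_add_iff' 1]
  convert Real.hasSum_pow_div_log_of_abs_lt_one h1 using 1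
  · rfl
  · funext n
    have : (0 : ℝ) ≤ n + 1 := by positivity
    simp [dirichletW, Real.sq_sqrt this]
  · simp [dirichletW]

lemma exists_mul_norm_kernel_le (hβ : β = hardyW ∨ β = dirichletW)
    (hk : ∀ z ∈ uDisc, ∀ n, k z n = (starRingEnd ℂ z) ^ n / β n) {C : ℝ} (hC : 1 ≤ C) :
    ∃ κ > 0, ∀ z ∈ uDisc, ∀ w ∈ uDisc, 1 - ‖w‖ ^ 2 ≤ C * (1 - ‖z‖ ^ 2) →
      κ * ‖k z‖ ^ 2 ≤ ‖k w‖ ^ 2 := by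
  have hpos : ∀ z ∈ uDisc, 0 < 1 - ‖z‖ ^ 2 := fun z hz => by
    have hz1 : ‖z‖ < 1 := mem_ball_zero_iff.1 hz
    nlinarith [norm_nonneg z]
  have hC0 : 0 < C := by linarith
  rcases hβ with rfl | rfl
  · refine ⟨C⁻¹, by positivity, fun z hz w hw h => ?_⟩
    rw [norm_kernel_sq_hardy hk hz, norm_kernel_sq_hardy hk hw, ← mul_inv]
    exact inv_anti₀ (hpos w hw) h
  · have hlogC : 0 ≤ Real.log C := Real.log_nonneg hC
    refine ⟨(1 + Real.log C)⁻¹, by positivity, fun z hz w hw h => ?_⟩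
    rw [norm_kernel_sq_dirichlet hk hz, norm_kernel_sq_dirichlet hk hw,
      inv_mul_le_iff₀ (by positivity)]
    have h1 := Real.log_le_log (hpos w hw) h
    rw [Real.log_mul hC0.ne' (hpos z hz).ne'] at h1
    have h2 : Real.log (1 - ‖w‖ ^ 2) ≤ 0 :=
      Real.log_nonpos (hpos w hw).le (by linarith [sq_nonneg ‖w‖])
    nlinarith

lemma tendsto_norm_kernel_atTop (hβ : β = hardyW ∨ β = dirichletW)
    (hk : ∀ z ∈ uDisc, ∀ n, k z n = (starRingEnd ℂ z) ^ n / β n) {z : ℕ → ℂ}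
    (hz : ∀ n, z n ∈ uDisc) (hz1 : Tendsto (fun n => ‖z n‖) atTop (𝓝 1)) :
    Tendsto (fun n => ‖k (z n)‖) atTop atTop := by
  have hlim : Tendsto (fun n => 1 - ‖z n‖ ^ 2) atTop (𝓝[>] 0) := by
    refine tendsto_nhdsWithin_iff.2 ⟨?_, Eventually.of_forall fun n => ?_⟩
    · simpa using (hz1.pow 2).const_sub 1
    · have := mem_ball_zero_iff.1 (hz n)
      simp only [mem_Ioi]
      nlinarith [norm_nonneg (z n)]
  have hsq : Tendsto (fun n => ‖k (z n)‖ ^ 2) atTop atTop := by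
    rcases hβ with rfl | rfl
    · simp_rw [norm_kernel_sq_hardy hk (hz _)]
      exact tendsto_inv_nhdsGT_zero.comp hlim
    · simp_rw [norm_kernel_sq_dirichlet hk (hz _)]
      exact tendsto_atTop_add_const_left _ 1
        (tendsto_neg_atBot_atTop.comp (Real.tendsto_log_nhdsGT_zero.comp hlim))
  have := Real.tendsto_sqrt_atTop.comp hsq
  refine this.congr fun n => ?_
  simp

end Kernel

/-- Bounded coordinatewise null sequences in `ℓ²` are weakly null. -/
lemma tendsto_inner_of_coord {u : ℕ → WH2} (hu : ∀ n, ‖u n‖ ≤ 1)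
    (hcoord : ∀ i, Tendsto (fun n => u n i) atTop (𝓝 0)) (y : WH2) :
    Tendsto (fun n => inner ℂ (u n) y) atTop (𝓝 0) := by
  rw [Metric.tendsto_atTop]
  intro ε hε
  obtain ⟨s, hs⟩ := ((Metric.tendsto_nhds.1 (lp.hasSum_single (by norm_num) y)) (ε / 2)
    (by positivity)).exists
  have hfin : Tendsto (fun n => inner ℂ (u n) (∑ i ∈ s, lp.single 2 i (y i))) atTop (𝓝 0) := by
    simp_rw [inner_sum, lp.inner_single_right, RCLike.inner_apply]
    have hterm : ∀ i ∈ s, Tendsto (fun n => y i * (starRingEnd ℂ) (u n i)) atTop (𝓝 0) := by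
      intro i _
      have := ((continuous_conj.tendsto 0).comp (hcoord i)).const_mul (y i)
      simpa using this
    have := tendsto_finsetSum s hterm
    rwa [Finset.sum_const_zero] at this
  obtain ⟨N, hN⟩ := Metric.tendsto_atTop.1 hfin (ε / 2) (by positivity)
  refine ⟨N, fun n hn => ?_⟩
  have h1 := hN n hn
  rw [dist_zero_right] at h1 ⊢
  have h2 : ‖inner ℂ (u n) (y - ∑ i ∈ s, lp.single 2 i (y i))‖ < ε / 2 := by
    refine (norm_inner_le_norm _ _).trans_lt ?_
    rw [dist_comm, dist_eq_norm] at hs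
    exact (mul_le_of_le_one_left (norm_nonneg _) (hu n)).trans_lt hs
  rw [inner_sub_right] at h2
  have h3 := norm_add_le (inner ℂ (u n) y - inner ℂ (u n) (∑ i ∈ s, lp.single 2 i (y i)))
    (inner ℂ (u n) (∑ i ∈ s, lp.single 2 i (y i)))
  rw [sub_add_cancel] at h3
  linarith

/-- The adjoint of a compact operator cannot be bounded below along a bounded weakly null
sequence. -/
lemma IsCompactOperator.not_le_norm_adjoint {X : Type*} [NormedAddCommGroup X]
    [InnerProductSpace ℂ X] [CompleteSpace X] {T : X →L[ℂ] X} (hT : IsCompactOperator T)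
    {u : ℕ → X} (hu : ∀ n, ‖u n‖ ≤ 1)
    (hweak : ∀ y, Tendsto (fun n => inner ℂ (u n) y) atTop (𝓝 0)) {κ : ℝ} (hκ : 0 < κ) :
    ¬ ∀ n, κ ≤ ‖ContinuousLinearMap.adjoint T (u n)‖ ^ 2 := by
  intro hle
  obtain ⟨K, hK, hsub⟩ := IsCompactOperator.image_closedBall_subset_compact (𝕜₁ := ℂ)
    (f := (T : X →ₛₗ[RingHom.id ℂ] X)) hT ‖ContinuousLinearMap.adjoint T‖
  have hmem : ∀ n, T (ContinuousLinearMap.adjoint T (u n)) ∈ K := fun n => by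
    refine hsub ⟨_, ?_, rfl⟩
    rw [mem_closedBall_zero_iff]
    exact (ContinuousLinearMap.le_opNorm _ _).trans
      (mul_le_of_le_one_right (norm_nonneg _) (hu n))
  obtain ⟨y, -, ψ, hψ, hlim⟩ := hK.tendsto_subseq hmem
  have h1 : Tendsto (fun n => ‖T (ContinuousLinearMap.adjoint T (u (ψ n))) - y‖ +
      ‖inner ℂ (u (ψ n)) y‖) atTop (𝓝 (0 + 0)) := by
    refine Tendsto.add ?_ ?_
    · simpa using (hlim.sub_const y).norm
    · simpa using ((hweak y).comp hψ.tendsto_atTop).norm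
  rw [add_zero] at h1
  refine absurd (ge_of_tendsto' h1 (fun n => ?_)) (not_le.2 hκ)
  refine (hle (ψ n)).trans ?_
  have h2 : ‖ContinuousLinearMap.adjoint T (u (ψ n))‖ ^ 2 =
      ‖inner ℂ (u (ψ n)) (T (ContinuousLinearMap.adjoint T (u (ψ n))))‖ := by
    rw [← ContinuousLinearMap.adjoint_inner_left, inner_self_eq_norm_sq_to_K]
    simp
  rw [h2]
  have h3 : inner ℂ (u (ψ n)) (T (ContinuousLinearMap.adjoint T (u (ψ n)))) =
      inner ℂ (u (ψ n)) (T (ContinuousLinearMap.adjoint T (u (ψ n))) - y) +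
        inner ℂ (u (ψ n)) y := by
    rw [inner_sub_right]; ring
  rw [h3]
  refine (norm_add_le _ _).trans (add_le_add_left ?_ _)
  exact (norm_inner_le_norm _ _).trans (mul_le_of_le_one_left (norm_nonneg _) (hu _))

/-- The symbol of a compact composition operator has no finite angular derivative. -/
lemma RepresentsComp.not_compact {β : ℕ → ℝ} (hβ : β = hardyW ∨ β = dirichletW)
    {T : WH2 →L[ℂ] WH2} {φ : ℂ → ℂ} (hrep : RepresentsComp β T φ) {z : ℕ → ℂ}
    (hz : ∀ n, z n ∈ uDisc) (hz1 : Tendsto (fun n => ‖z n‖) atTop (𝓝 1)) {C : ℝ}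
    (hC : ∀ n, 1 - ‖φ (z n)‖ ≤ C * (1 - ‖z n‖)) : ¬ IsCompactOperator T := by
  intro hT
  obtain ⟨-, hmaps, hcomp⟩ := hrep
  have hβ1 := one_le_weight hβ
  obtain ⟨k, hk⟩ := exists_kernel hβ1
  have hadj : ∀ w ∈ uDisc, ContinuousLinearMap.adjoint T (k w) = k (φ w) := by
    intro w hw
    refine ext_inner_right ℂ fun f => ?_
    rw [ContinuousLinearMap.adjoint_inner_left, inner_kernel hk _ hw, hcomp f w hw,
      inner_kernel hk _ (hmaps hw)]
  have hkpos : ∀ w ∈ uDisc, 0 < ‖k w‖ := by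
    intro w hw
    refine norm_pos_iff.2 fun h => ?_
    have h0 := hk w hw 0
    have hb := hβ1 0
    rw [h] at h0
    have : (β 0 : ℂ) ≠ 0 := by
      exact_mod_cast (zero_lt_one.trans_le hb).ne'
    simp at h0
    exact this h0.symm
  have hC' : ∀ n, 1 - ‖φ (z n)‖ ^ 2 ≤ max 1 (2 * C) * (1 - ‖z n‖ ^ 2) := by
    intro n
    have h1 := mem_ball_zero_iff.1 (hz n)
    have h2 := mem_ball_zero_iff.1 (hmaps (hz n))
    have h3 := norm_nonneg (z n)
    have h4 := norm_nonneg (φ (z n))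
    have hC0 : 0 < C := by
      by_contra! h
      nlinarith [hC n]
    calc 1 - ‖φ (z n)‖ ^ 2 ≤ 2 * (1 - ‖φ (z n)‖) := by nlinarith
      _ ≤ 2 * C * (1 - ‖z n‖) := by nlinarith [hC n]
      _ ≤ 2 * C * (1 - ‖z n‖ ^ 2) := by
        apply mul_le_mul_of_nonneg_left _ (by positivity)
        nlinarith
      _ ≤ _ := by
        apply mul_le_mul_of_nonneg_right (le_max_right _ _)
        nlinarith
  obtain ⟨κ, hκ, hle⟩ := exists_mul_norm_kernel_le hβ hk (le_max_left 1 (2 * C))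
  set u : ℕ → WH2 := fun n => ((‖k (z n)‖⁻¹ : ℝ) : ℂ) • k (z n) with hu
  have hunorm : ∀ n, ‖u n‖ ≤ 1 := by
    intro n
    rw [hu, norm_smul, norm_real, norm_inv, norm_norm,
      inv_mul_cancel₀ (hkpos _ (hz n)).ne']
  refine hT.not_le_norm_adjoint hunorm (tendsto_inner_of_coord hunorm fun i => ?_) hκ fun n => ?_
  · have hinv : Tendsto (fun n => ‖k (z n)‖⁻¹) atTop (𝓝 0) :=
      tendsto_inv_atTop_zero.comp (tendsto_norm_kernel_atTop hβ hk hz hz1)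
    refine squeeze_zero_norm (fun n => ?_) hinv
    change ‖((‖k (z n)‖⁻¹ : ℝ) : ℂ) * k (z n) i‖ ≤ _
    rw [norm_mul, norm_real, norm_inv, norm_norm, hk _ (hz n)]
    refine mul_le_of_le_one_right (by positivity) ?_
    rw [norm_div, norm_pow, RCLike.norm_conj, norm_real, Real.norm_eq_abs]
    have h1 := mem_ball_zero_iff.1 (hz n)
    exact div_le_one_of_le₀ ((pow_le_one₀ (norm_nonneg _) h1.le).trans
      ((hβ1 i).trans (le_abs_self _))) (abs_nonneg _)
  · have h1 := hle _ (hz n) _ (hmaps (hz n)) (hC' n)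
    have h2 := hkpos _ (hz n)
    rw [hu, map_smul, hadj _ (hz n), norm_smul, norm_real, norm_inv, norm_norm, mul_pow, inv_pow,
      inv_mul_eq_div, le_div_iff₀ (by positivity)]
    exact h1


lemma norm_fourier_one (x : AddCircle (1 : ℝ)) : ‖(fourier 1 x : ℂ)‖ = 1 := by
  rw [fourier_apply]
  exact Circle.norm_coe _

/-- Parseval's identity for absolutely convergent one-sided Fourier series. -/
lemma hasSum_norm_sq_integral {b : ℕ → ℂ} (hb : Summable fun n => ‖b n‖) :
    HasSum (fun n => ‖b n‖ ^ 2)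
      (∫ x : AddCircle (1 : ℝ), ‖∑' n, b n * (fourier 1 x) ^ n‖ ^ 2
        ∂AddCircle.haarAddCircle) := by
  have hs : Summable fun n : ℕ => b n • (fourier (n : ℤ) : C(AddCircle (1 : ℝ), ℂ)) := by
    refine Summable.of_norm ?_
    simpa [norm_smul, fourier_norm] using hb
  obtain ⟨F, hF⟩ := hs
  have hFx : ∀ x, F x = ∑' n, b n * (fourier 1 x) ^ n := by
    intro x
    have := ((ContinuousMap.evalCLM ℂ x).hasSum hF).tsum_eq
    rw [ContinuousMap.evalCLM_apply] at this
    rw [← this]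
    refine tsum_congr fun n => ?_
    simp [fourier_apply, AddCircle.toCircle_nsmul]
  set v : ℕ → Lp ℂ 2 (AddCircle.haarAddCircle (T := (1 : ℝ))) :=
    fun n => fourierLp 2 (n : ℤ) with hv
  have hon : Orthonormal ℂ v := orthonormal_fourier.comp _ Nat.cast_injective
  set L := ContinuousMap.toLp (E := ℂ) 2 (AddCircle.haarAddCircle (T := (1 : ℝ))) ℂ with hL
  have hLF : HasSum (fun n => b n • v n) (L F) := by
    have := L.hasSum hF
    simpa [hv, fourierLp, hL] using this
  have hcoef : ∀ n, inner ℂ (v n) (L F) = b n := by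
    intro n
    have h1 := (innerSL ℂ (v n)).hasSum hLF
    refine h1.unique ?_
    convert hasSum_single n ?_ using 1
    · rw [innerSL_apply_apply, inner_smul_right, orthonormal_iff_ite.1 hon]
      simp
    · intro m hm
      rw [innerSL_apply_apply, inner_smul_right, orthonormal_iff_ite.1 hon]
      simp [hm.symm]
  have h2 : HasSum (fun n => ((‖b n‖ ^ 2 : ℝ) : ℂ)) ((‖L F‖ ^ 2 : ℝ) : ℂ) := by
    have h1 := (innerSL ℂ (L F)).hasSum hLF
    convert h1 using 1
    · rfl
    · funext n
      rw [innerSL_apply_apply, inner_smul_right, ← inner_conj_symm, hcoef, mul_comm,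
        Complex.conj_mul']
      push_cast
      rfl
    · rw [innerSL_apply_apply, inner_self_eq_norm_sq_to_K]
      push_cast
      rfl
  have h3 : HasSum (fun n => ‖b n‖ ^ 2) (‖L F‖ ^ 2) := by exact_mod_cast h2
  convert h3 using 1
  have h4 : ‖L F‖ ^ 2 = ∫ x, ‖L F x‖ ^ 2 ∂AddCircle.haarAddCircle (T := (1 : ℝ)) := by
    have h5 : ((‖L F‖ ^ 2 : ℝ) : ℂ) =
        ((∫ x, ‖L F x‖ ^ 2 ∂AddCircle.haarAddCircle (T := (1 : ℝ)) : ℝ) : ℂ) := by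
      rw [← integral_complex_ofReal]
      push_cast
      have := inner_self_eq_norm_sq_to_K (𝕜 := ℂ) (L F)
      rw [L2.inner_def] at this
      simp only [inner_self_eq_norm_sq_to_K] at this
      exact this.symm
    exact_mod_cast h5
  rw [h4]
  refine integral_congr_ae ?_
  filter_upwards [ContinuousMap.coeFn_toLp (p := 2) (𝕜 := ℂ)
    (AddCircle.haarAddCircle (T := (1 : ℝ))) F] with x hx
  rw [← hFx, hL, hx]

/-- Comparison of coefficients from pointwise comparison of absolutely convergent series. -/
lemma tsum_norm_sq_le_of_norm_le {a b : ℕ → ℂ} {ρ K : ℝ} (hρ : 0 ≤ ρ)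
    (ha : Summable fun n => ‖a n‖ * ρ ^ n) (hb : Summable fun n => ‖b n‖ * ρ ^ n)
    (hle : ∀ z : ℂ, ‖z‖ = ρ → ‖∑' n, a n * z ^ n‖ ^ 2 ≤ K * ‖∑' n, b n * z ^ n‖ ^ 2) :
    Summable (fun n => ‖a n‖ ^ 2 * (ρ ^ 2) ^ n) ∧ Summable (fun n => ‖b n‖ ^ 2 * (ρ ^ 2) ^ n) ∧
    ∑' n, ‖a n‖ ^ 2 * (ρ ^ 2) ^ n ≤ K * ∑' n, ‖b n‖ ^ 2 * (ρ ^ 2) ^ n := by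
  have key : ∀ c : ℕ → ℂ, (Summable fun n => ‖c n‖ * ρ ^ n) →
      HasSum (fun n => ‖c n‖ ^ 2 * (ρ ^ 2) ^ n)
        (∫ x : AddCircle (1 : ℝ), ‖∑' n, c n * (ρ * fourier 1 x) ^ n‖ ^ 2
          ∂AddCircle.haarAddCircle) ∧
      Continuous fun x : AddCircle (1 : ℝ) => ∑' n, c n * (ρ * fourier 1 x) ^ n := by
    intro c hc
    constructor
    · have := hasSum_norm_sq_integral (b := fun n => c n * (ρ : ℂ) ^ n)
        (by simpa [abs_of_nonneg hρ] using hc)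
      convert this using 1
      · funext n
        simp [abs_of_nonneg hρ, mul_pow, ← pow_mul, mul_comm]
      · simp_rw [mul_pow, mul_assoc]
    · refine continuous_tsum (fun n => by fun_prop) hc fun n x => ?_
      rw [norm_mul, norm_pow, norm_mul, norm_fourier_one, norm_real, Real.norm_of_nonneg hρ,
        mul_one]
  obtain ⟨ha1, ha2⟩ := key a ha
  obtain ⟨hb1, hb2⟩ := key b hb
  refine ⟨ha1.summable, hb1.summable, ?_⟩
  rw [ha1.tsum_eq, hb1.tsum_eq, ← integral_const_mul]
  refine integral_mono ?_ ?_ fun x => hle _ ?_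
  rotate_left 2
  · rw [norm_mul, norm_fourier_one, norm_real, Real.norm_of_nonneg hρ, mul_one]
  · exact (ha2.norm.pow 2).integrable_of_hasCompactSupport
      (HasCompactSupport.of_compactSpace _)
  · exact (continuous_const.mul (hb2.norm.pow 2)).integrable_of_hasCompactSupport
      (HasCompactSupport.of_compactSpace _)

lemma summable_coeff_mul_pow {a : ℕ → ℂ} {M : ℝ} (ha : ∀ n, ‖a n‖ ≤ M) {ρ : ℝ} (hρ : 0 ≤ ρ)
    (hρ1 : ρ < 1) : Summable fun n => ‖a n‖ * ρ ^ n :=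
  Summable.of_nonneg_of_le (fun n => by positivity)
    (fun n => mul_le_mul_of_nonneg_right (ha n) (by positivity))
    ((summable_geometric_of_lt_one hρ hρ1).mul_left M)

lemma summable_natCast_mul_coeff_mul_pow {a : ℕ → ℂ} {M : ℝ} (ha : ∀ n, ‖a n‖ ≤ M) {ρ : ℝ}
    (hρ : 0 ≤ ρ) (hρ1 : ρ < 1) : Summable fun n : ℕ => ‖(n : ℂ) * a n‖ * ρ ^ n := by
  have h1 := (summable_pow_mul_geometric_of_norm_lt_one 1
    (by rwa [Real.norm_of_nonneg hρ] : ‖ρ‖ < 1)).mul_left M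
  refine Summable.of_nonneg_of_le (fun n => by positivity) (fun n => ?_) h1
  rw [norm_mul, Complex.norm_natCast, pow_one, mul_comm (n : ℝ), mul_assoc]
  exact mul_le_mul_of_nonneg_right (ha n) (by positivity)

/-- Termwise differentiation of a power series with bounded coefficients. -/
lemma mul_deriv_tsum {a : ℕ → ℂ} {M : ℝ} (ha : ∀ n, ‖a n‖ ≤ M) {z : ℂ} (hz : z ∈ uDisc) :
    DifferentiableAt ℂ (fun w => ∑' n, a n * w ^ n) z ∧
    z * deriv (fun w => ∑' n, a n * w ^ n) z = ∑' n : ℕ, ((n : ℂ) * a n) * z ^ n := by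
  have hz1 : ‖z‖ < 1 := mem_ball_zero_iff.1 hz
  obtain ⟨ρ, hzρ, hρ1⟩ := exists_between hz1
  have hρ : 0 < ρ := (norm_nonneg z).trans_lt hzρ
  have hu : Summable fun n : ℕ => M * ((n : ℝ) * ρ ^ (n - 1)) := by
    refine Summable.mul_left M ?_
    rw [← summable_nat_add_iff 1]
    have h0 := summable_pow_mul_geometric_of_norm_lt_one (R := ℝ) 1
      (by rwa [Real.norm_of_nonneg hρ.le] : ‖ρ‖ < 1)
    have h1 := (summable_nat_add_iff 1).2 h0
    refine (h1.mul_left ρ⁻¹).congr fun n => ?_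
    rw [Nat.add_sub_cancel, pow_one, pow_succ]
    field_simp
  have hd : HasDerivAt (fun w => ∑' n, a n * w ^ n)
      (∑' n : ℕ, a n * ((n : ℂ) * z ^ (n - 1))) z := by
    refine hasDerivAt_tsum_of_isPreconnected (g := fun n w => a n * w ^ n)
      (g' := fun n w => a n * ((n : ℂ) * w ^ (n - 1))) hu (isOpen_ball (x := (0 : ℂ)) (ε := ρ))
      (convex_ball _ _).isPreconnected (fun n y _ => (hasDerivAt_pow n y).const_mul (a n))
      (fun n y hy => ?_) (mem_ball_zero_iff.2 hzρ) ?_ (mem_ball_zero_iff.2 hzρ)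
    · rw [mem_ball_zero_iff] at hy
      rw [norm_mul, norm_mul, norm_pow, Complex.norm_natCast]
      have := ha n
      gcongr
      exact (norm_nonneg _).trans this
    · refine Summable.of_norm ?_
      simpa using summable_coeff_mul_pow ha (norm_nonneg z) hz1
  refine ⟨hd.differentiableAt, ?_⟩
  rw [hd.deriv, ← tsum_mul_left]
  refine tsum_congr fun n => ?_
  rcases n with _ | n
  · simp
  · simp only [Nat.add_sub_cancel, pow_succ]
    ring

/-- Integrating a comparison of power series over `(0, 1)`. -/
lemma tsum_div_le_of_tsum_le {A B : ℕ → ℝ} (hA : ∀ n, 0 ≤ A n) (hB : ∀ n, 0 ≤ B n) {K : ℝ}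
    (hK : 0 ≤ K)
    (hle : ∀ x ∈ Ioo (0 : ℝ) 1, Summable (fun n => A n * x ^ n) ∧
      Summable (fun n => B n * x ^ n) ∧ ∑' n, A n * x ^ n ≤ K * ∑' n, B n * x ^ n)
    (hAs : Summable fun n : ℕ => A n / (n + 1)) (hBs : Summable fun n : ℕ => B n / (n + 1)) :
    ∑' n : ℕ, A n / (n + 1) ≤ K * ∑' n : ℕ, B n / (n + 1) := by
  have hpow : ∀ (D : ℕ → ℝ), (∀ n, 0 ≤ D n) →
      ∫⁻ x in Ioo (0 : ℝ) 1, ∑' n, ENNReal.ofReal (D n * x ^ n) =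
        ∑' n : ℕ, ENNReal.ofReal (D n / (n + 1)) := by
    intro D hD
    rw [lintegral_tsum fun n => by fun_prop]
    refine tsum_congr fun n => ?_
    rw [← ofReal_integral_eq_lintegral_ofReal]
    · rw [← integral_Ioc_eq_integral_Ioo, ← intervalIntegral.integral_of_le zero_le_one]
      simp [integral_pow, div_eq_mul_inv]
    · exact (Continuous.integrableOn_Icc (by fun_prop)).mono_set Ioo_subset_Icc_self
    · refine (ae_restrict_iff' measurableSet_Ioo).2 (Eventually.of_forall fun x hx => ?_)
      exact mul_nonneg (hD n) (pow_nonneg hx.1.le n)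
  have h1 : ∑' n : ℕ, ENNReal.ofReal (A n / (n + 1)) ≤
      ENNReal.ofReal K * ∑' n : ℕ, ENNReal.ofReal (B n / (n + 1)) := by
    rw [← hpow A hA, ← hpow B hB, ← lintegral_const_mul' _ _ ENNReal.ofReal_ne_top]
    refine setLIntegral_mono' measurableSet_Ioo fun x hx => ?_
    obtain ⟨h1, h2, h3⟩ := hle x hx
    rw [← ENNReal.ofReal_tsum_of_nonneg (fun n => mul_nonneg (hA n) (pow_nonneg hx.1.le n)) h1,
      ← ENNReal.ofReal_tsum_of_nonneg (fun n => mul_nonneg (hB n) (pow_nonneg hx.1.le n)) h2,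
      ← ENNReal.ofReal_mul hK]
    exact ENNReal.ofReal_le_ofReal h3
  have hA' : ∀ n : ℕ, 0 ≤ A n / (n + 1) := fun n => div_nonneg (hA n) (by positivity)
  have hB' : ∀ n : ℕ, 0 ≤ B n / (n + 1) := fun n => div_nonneg (hB n) (by positivity)
  rw [← ENNReal.ofReal_tsum_of_nonneg hA' hAs, ← ENNReal.ofReal_tsum_of_nonneg hB' hBs,
    ← ENNReal.ofReal_mul hK] at h1
  exact (ENNReal.ofReal_le_ofReal_iff (mul_nonneg hK (tsum_nonneg hB'))).1 h1

section HilbertSchmidt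

variable {β : ℕ → ℝ} {T : WH2 →L[ℂ] WH2} {φ : ℂ → ℂ}

lemma norm_coeff_div_le (hβ : ∀ n, 1 ≤ β n) (g : WH2) (m : ℕ) : ‖g m / (β m : ℂ)‖ ≤ ‖g‖ := by
  rw [norm_div, norm_real, Real.norm_eq_abs]
  exact (div_le_self (norm_nonneg _) ((hβ m).trans (le_abs_self _))).trans
    (lp.norm_apply_le_norm (by norm_num) g m)

lemma RepresentsComp.wToFun_single (hrep : RepresentsComp β T φ) (n : ℕ) {z : ℂ}
    (hz : z ∈ uDisc) : wToFun β (T (lp.single 2 n 1)) z = φ z ^ n / β n := by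
  rw [hrep.2.2 _ z hz, wToFun, tsum_eq_single n]
  · simp [div_eq_inv_mul]
  · intro m hm
    simp [hm]

lemma RepresentsComp.norm_sq_single_le_hardy (hrep : RepresentsComp hardyW T φ) {r : ℝ}
    (hφ : ∀ z ∈ uDisc, ‖φ z‖ ≤ r) (n : ℕ) :
    ‖T (lp.single 2 n (1 : ℂ))‖ ^ 2 ≤ (r ^ 2) ^ n := by
  set g := T (lp.single 2 n (1 : ℂ)) with hg
  have hβ := one_le_weight (.inl rfl : hardyW = hardyW ∨ hardyW = dirichletW)
  have hρ : ∀ ρ ∈ Ioo (0 : ℝ) 1, ∀ s : Finset ℕ,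
      ∑ m ∈ s, ‖g m‖ ^ 2 * (ρ ^ 2) ^ m ≤ (r ^ 2) ^ n := by
    intro ρ hρ s
    have hbs : Summable fun m : ℕ => ‖if m = 0 then (1 : ℂ) else 0‖ * ρ ^ m :=
      summable_of_ne_finset_zero (s := {0}) fun m hm => by simp at hm; simp [hm]
    obtain ⟨h1, -, h3⟩ := tsum_norm_sq_le_of_norm_le (K := (r ^ 2) ^ n) hρ.1.le
      (summable_coeff_mul_pow (norm_coeff_div_le hβ g) hρ.1.le hρ.2) hbs fun z hz => by
        have hzD : z ∈ uDisc := mem_ball_zero_iff.2 (hz ▸ hρ.2)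
        have h4 : ∑' m : ℕ, (if m = 0 then (1 : ℂ) else 0) * z ^ m = 1 := by
          rw [tsum_eq_single 0] <;> simp +contextual
        rw [h4, ← wToFun, hg, hrep.wToFun_single n hzD]
        simp only [hardyW, ofReal_one, div_one, norm_pow, norm_one, one_pow, mul_one]
        rw [← pow_mul, ← pow_mul, mul_comm 2 n]
        exact pow_le_pow_left₀ (norm_nonneg _) (hφ z hzD) _
    have h5 : ∑' m : ℕ, ‖if m = 0 then (1 : ℂ) else 0‖ ^ 2 * (ρ ^ 2) ^ m = 1 := by
      rw [tsum_eq_single 0] <;> simp +contextual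
    rw [h5, mul_one] at h3
    refine le_trans ?_ h3
    have := h1.sum_le_tsum s fun m _ => by positivity
    simpa [hardyW] using this
  refine hasSum_le_of_sum_le (WH2.hasSum_norm_sq g) fun s => ?_
  have hcont : Tendsto (fun ρ : ℝ => ∑ m ∈ s, ‖g m‖ ^ 2 * (ρ ^ 2) ^ m) (𝓝[<] 1)
      (𝓝 (∑ m ∈ s, ‖g m‖ ^ 2 * ((1 : ℝ) ^ 2) ^ m)) :=
    (Continuous.tendsto (by fun_prop) 1).mono_left nhdsWithin_le_nhds
  simp only [one_pow, mul_one] at hcont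
  refine le_of_tendsto hcont ?_
  filter_upwards [Ioo_mem_nhdsLT zero_lt_one] with ρ h using hρ ρ h s

lemma RepresentsComp.norm_sq_single_le_dirichlet (hrep : RepresentsComp dirichletW T φ) {r : ℝ}
    (hφ : ∀ z ∈ uDisc, ‖φ z‖ ≤ r) (n : ℕ) :
    ‖T (lp.single 2 (n + 1) (1 : ℂ))‖ ^ 2 ≤
      (r ^ 2) ^ (n + 1) + (n + 1) * (r ^ 2) ^ n * ‖T (lp.single 2 1 (1 : ℂ))‖ ^ 2 := by
  have hβ := one_le_weight (.inr rfl : dirichletW = hardyW ∨ dirichletW = dirichletW)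
  set G := fun n => T (lp.single 2 n (1 : ℂ)) with hG
  have hopen : IsOpen uDisc := isOpen_ball
  have hfun : ∀ n, ∀ z ∈ uDisc, ∑' m, (G n m / (dirichletW m : ℂ)) * z ^ m =
    φ z ^ n / dirichletW n := fun n z hz => hrep.wToFun_single n hz
  have hderiv : ∀ n, ∀ z ∈ uDisc, ∑' m : ℕ, ((m : ℂ) * (G n m / (dirichletW m : ℂ))) * z ^ m =
      z * (n * φ z ^ (n - 1) * deriv φ z / dirichletW n) := by
    intro n z hz
    rw [← (mul_deriv_tsum (norm_coeff_div_le hβ (G n)) hz).2]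
    have h1 : (fun w => ∑' m, (G n m / (dirichletW m : ℂ)) * w ^ m) =ᶠ[𝓝 z]
        fun w => φ w ^ n / dirichletW n := by
      filter_upwards [hopen.mem_nhds hz] with w hw using hfun n w hw
    have h2 := ((hrep.1.differentiableAt (hopen.mem_nhds hz)).hasDerivAt.pow n).div_const
      (dirichletW n : ℂ)
    rw [h1.deriv_eq]
    congr 1
    exact h2.deriv
  have hd1 : dirichletW 1 = 1 := by simp [dirichletW]
  have hds : dirichletW (n + 1) ^ 2 = n + 1 := by
    have : (0 : ℝ) ≤ n + 1 := by positivity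
    simp [dirichletW, Real.sq_sqrt this]
  have hcmp : ∀ z ∈ uDisc,
      ‖∑' m : ℕ, ((m : ℂ) * (G (n + 1) m / (dirichletW m : ℂ))) * z ^ m‖ ^ 2 ≤
      ((n + 1) * (r ^ 2) ^ n) *
        ‖∑' m : ℕ, ((m : ℂ) * (G 1 m / (dirichletW m : ℂ))) * z ^ m‖ ^ 2 := by
    intro z hz
    rw [hderiv _ z hz, hderiv _ z hz, hd1]
    simp only [Nat.add_sub_cancel, Nat.sub_self, pow_zero, Nat.cast_one, ofReal_one, div_one,
      one_mul, norm_mul, norm_div, norm_pow, norm_real, mul_pow, div_pow, Complex.norm_natCast,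
      Real.norm_eq_abs, sq_abs, hds]
    push_cast
    have h1 : (‖φ z‖ ^ n) ^ 2 ≤ (r ^ 2) ^ n := by
      rw [← pow_mul, ← pow_mul, mul_comm 2 n]
      exact pow_le_pow_left₀ (norm_nonneg _) (hφ z hz) _
    have h2 : (0 : ℝ) < n + 1 := by positivity
    calc _ = ((n + 1) * (‖φ z‖ ^ n) ^ 2) * (‖z‖ ^ 2 * ‖deriv φ z‖ ^ 2) := by
          field_simp
      _ ≤ _ := by gcongr
  have hcoef : ∀ k m : ℕ,
      ‖((m + 1 : ℕ) : ℂ) * (G k (m + 1) / (dirichletW (m + 1) : ℂ))‖ ^ 2 / (m + 1) =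
        ‖G k (m + 1)‖ ^ 2 := by
    intro k m
    have h2 : (0 : ℝ) < m + 1 := by positivity
    have h3 : dirichletW (m + 1) ^ 2 = m + 1 := by
      simp [dirichletW, Real.sq_sqrt h2.le]
    rw [norm_mul, norm_div, norm_real, mul_pow, div_pow, Real.norm_eq_abs, sq_abs, h3,
      Complex.norm_natCast]
    push_cast
    field_simp
  have hsumG : ∀ k, HasSum (fun m => ‖G k (m + 1)‖ ^ 2) (‖G k‖ ^ 2 - ‖G k 0‖ ^ 2) := by
    intro k
    have := (hasSum_nat_add_iff' 1).2 (WH2.hasSum_norm_sq (G k))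
    simpa using this
  have hmain := tsum_div_le_of_tsum_le
    (A := fun m => ‖((m + 1 : ℕ) : ℂ) * (G (n + 1) (m + 1) / (dirichletW (m + 1) : ℂ))‖ ^ 2)
    (B := fun m => ‖((m + 1 : ℕ) : ℂ) * (G 1 (m + 1) / (dirichletW (m + 1) : ℂ))‖ ^ 2)
    (fun m => by positivity) (fun m => by positivity)
    (K := (n + 1) * (r ^ 2) ^ n) (by positivity) (fun x hx => ?_)
    (by simp_rw [hcoef]; exact (hsumG _).summable) (by simp_rw [hcoef]; exact (hsumG _).summable)
  · simp_rw [hcoef] at hmain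
    rw [(hsumG _).tsum_eq, (hsumG _).tsum_eq] at hmain
    have h0 : ‖G (n + 1) 0‖ ^ 2 ≤ (r ^ 2) ^ (n + 1) := by
      have h0D : (0 : ℂ) ∈ uDisc := mem_ball_self zero_lt_one
      have h1 := hfun (n + 1) 0 h0D
      rw [tsum_eq_single 0 (fun m hm => by simp [hm])] at h1
      have h2 : G (n + 1) 0 = φ 0 ^ (n + 1) / dirichletW (n + 1) := by
        rw [← h1]; simp [dirichletW]
      rw [← pow_mul, mul_comm 2, pow_mul, h2, norm_div, norm_pow, norm_real, Real.norm_eq_abs]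
      refine pow_le_pow_left₀ (by positivity) ?_ 2
      exact (div_le_self (by positivity) ((hβ _).trans (le_abs_self _))).trans
        (pow_le_pow_left₀ (norm_nonneg _) (hφ 0 h0D) _)
    have h1 : 0 ≤ ((n + 1) * (r ^ 2) ^ n) * ‖G 1 0‖ ^ 2 := by positivity
    change ‖G (n + 1)‖ ^ 2 ≤ _ + _ * ‖G 1‖ ^ 2
    linarith
  · have hρ0 : 0 < √x := Real.sqrt_pos.2 hx.1
    have hρ1 : √x < 1 := by rw [Real.sqrt_lt' zero_lt_one]; simpa using hx.2
    obtain ⟨h1, h2, h3⟩ := tsum_norm_sq_le_of_norm_le hρ0.le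
      (summable_natCast_mul_coeff_mul_pow (norm_coeff_div_le hβ (G (n + 1))) hρ0.le hρ1)
      (summable_natCast_mul_coeff_mul_pow (norm_coeff_div_le hβ (G 1)) hρ0.le hρ1)
      fun z hz => hcmp z (mem_ball_zero_iff.2 (hz ▸ hρ1))
    rw [Real.sq_sqrt hx.1.le] at h1 h2 h3
    have hshift : ∀ {D : ℕ → ℝ}, D 0 = 0 → Summable (fun m => D m * x ^ m) →
        Summable (fun m => D (m + 1) * x ^ m) ∧
        ∑' m, D m * x ^ m = x * ∑' m, D (m + 1) * x ^ m := by
      intro D hD hs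
      have hs' := (summable_nat_add_iff 1).2 hs
      have hx0 := hx.1.ne'
      have hs'' : Summable (fun m => D (m + 1) * x ^ m) :=
        (hs'.mul_left x⁻¹).congr fun m => by
          rw [pow_succ]
          field_simp
      refine ⟨hs'', ?_⟩
      rw [hs.tsum_eq_zero_add, hD, zero_mul, zero_add, ← tsum_mul_left]
      refine tsum_congr fun m => ?_
      ring
    obtain ⟨h4, h5⟩ := hshift (by simp) h1
    obtain ⟨h6, h7⟩ := hshift (by simp) h2
    rw [h5, h7, mul_left_comm] at h3
    exact ⟨h4, h6, le_of_mul_le_mul_left h3 hx.1⟩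

/-- Composition operators whose symbol has supremum norm below one are Hilbert–Schmidt. -/
lemma RepresentsComp.isHilbertSchmidt (hβ : β = hardyW ∨ β = dirichletW)
    (hrep : RepresentsComp β T φ) (hφ : SupNormLtOne φ) : IsHilbertSchmidt T := by
  obtain ⟨r, hr1, hr⟩ := hφ
  have hr0 : 0 ≤ r := (norm_nonneg _).trans (hr 0 (mem_ball_self zero_lt_one))
  have hr2 : r ^ 2 < 1 := by nlinarith
  rcases hβ with rfl | rfl
  · exact Summable.of_nonneg_of_le (fun n => by positivity)
      (hrep.norm_sq_single_le_hardy hr) (summable_geometric_of_lt_one (by positivity) hr2)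
  · rw [IsHilbertSchmidt, ← summable_nat_add_iff 1]
    refine Summable.of_nonneg_of_le (fun n => by positivity)
      (hrep.norm_sq_single_le_dirichlet hr) ?_
    have h1 := summable_geometric_of_lt_one (sq_nonneg r) hr2
    have h2 := summable_pow_mul_geometric_of_norm_lt_one (R := ℝ) 1
      (by rwa [Real.norm_of_nonneg (sq_nonneg r)] : ‖r ^ 2‖ < 1)
    refine ((summable_nat_add_iff 1).2 h1).add ((Summable.mul_right _ ?_))
    refine (h2.add h1).congr fun n => ?_
    ring

end HilbertSchmidt

/-- Near the boundary of `Ω` the inverse of the conformal map `h` tends to the unit circle. -/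
lemma exists_forall_im_lt_norm {h g P : ℂ → ℂ} {Ω : Set ℂ} (hh : ContinuousOn h uDisc)
    (him : h '' uDisc = Ω) (hhg : ∀ w ∈ Ω, h (g w) = w) (hP : Continuous P)
    (hPΩ : ∀ z ∈ Icc (-1 : ℝ) 1 ×ℂ Ioc 0 1, P z ∈ Ω)
    (hbd : ∀ ξ ∈ Icc (-1 : ℝ) 1, P ξ ∉ Ω) {ε : ℝ} (hε : 0 < ε) :
    ∃ η > 0, ∀ z ∈ Icc (-1 : ℝ) 1 ×ℂ Ioc 0 1, z.im < η → 1 - ε < ‖g (P z)‖ := by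
  have hsub : closedBall (0 : ℂ) (1 - ε) ⊆ uDisc := closedBall_subset_ball (by linarith)
  have hK : IsCompact (h '' closedBall (0 : ℂ) (1 - ε)) :=
    (isCompact_closedBall _ _).image_of_continuousOn (hh.mono hsub)
  have hS : IsCompact ((fun x : ℝ => (x : ℂ)) '' Icc (-1) 1) :=
    isCompact_Icc.image continuous_ofReal
  obtain ⟨η, hη, hsubη⟩ := hS.exists_thickening_subset_open
    (hK.isClosed.isOpen_compl.preimage hP) (by
      rintro _ ⟨ξ, hξ, rfl⟩ hmem
      exact hbd ξ hξ (him ▸ image_mono hsub hmem))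
  refine ⟨η, hη, fun z hz hzη => ?_⟩
  by_contra! hle
  obtain ⟨hre, him'⟩ := mem_reProdIm.1 hz
  refine hsubη (mem_thickening_iff.2 ⟨_, ⟨z.re, hre, rfl⟩, ?_⟩)
    ⟨g (P z), mem_closedBall_zero_iff.2 hle, hhg _ (hPΩ z hz)⟩
  rw [dist_of_re_eq (by simp), Real.dist_eq, ofReal_im, sub_zero, abs_of_pos him'.1]
  exact hzη

/-- If a flow line runs along the boundary of `Ω`, with a one-sided strip inside `Ω`, then the
corresponding composition operator is not compact. -/
lemma RepresentsComp.not_compact_of_strip {β : ℕ → ℝ} (hβ : β = hardyW ∨ β = dirichletW)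
    {T : WH2 →L[ℂ] WH2} {φ h : ℂ → ℂ} {Ω : Set ℂ} {c w : ℂ} {σ δ r b s : ℝ}
    (hrep : RepresentsComp β T φ) (hh : DifferentiableOn ℂ h uDisc) (hinj : InjOn h uDisc)
    (him : h '' uDisc = Ω) (h0 : h 0 = 0)
    (hmodel : ∀ z ∈ uDisc, h (φ z) = Complex.exp (-(c * (s : ℂ))) * h z)
    (hw : w ≠ 0) (hσ : σ = 1 ∨ σ = -1) (hs : 0 ≤ s) (hr : 0 < r) (hrδ : r < δ)
    (hstrip : ∀ x y : ℝ, x ≤ b + r → 0 < y → y < δ → w * Complex.exp (c * (x + σ * y * I)) ∈ Ω)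
    (hbd : ∀ x : ℝ, b - s - r ≤ x → w * Complex.exp (c * x) ∉ Ω) : ¬ IsCompactOperator T := by
  obtain ⟨g, hgd, hgh⟩ := exists_holomorphic_inverse hh hinj
  rw [him] at hgd
  have hgΩ : ∀ u ∈ Ω, g u ∈ uDisc ∧ h (g u) = u := by
    intro u hu
    obtain ⟨z, hz, rfl⟩ := him ▸ hu
    rw [hgh z hz]
    exact ⟨hz, rfl⟩
  set P : ℝ → ℂ → ℂ := fun a ζ => w * Complex.exp (c * (a + σ * r * ζ)) with hPdef
  have hPd : ∀ a, Differentiable ℂ (P a) := fun a => by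
    simp only [hPdef]; fun_prop
  have hσabs : |σ| = 1 := by rcases hσ with rfl | rfl <;> simp
  have hreal : ∀ ξ ∈ Icc (-1 : ℝ) 1, |σ * r * ξ| ≤ r := by
    intro ξ hξ
    rw [abs_mul, abs_mul, hσabs, one_mul, abs_of_pos hr]
    exact mul_le_of_le_one_right hr.le (abs_le.2 hξ)
  have hPΩ : ∀ a ≤ b, ∀ z ∈ Icc (-1 : ℝ) 1 ×ℂ Ioc 0 1, P a z ∈ Ω := by
    intro a ha z hz
    obtain ⟨hre, him'⟩ := mem_reProdIm.1 hz
    have h1 := (abs_le.1 (hreal _ hre)).2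
    have h2 := hstrip (a + σ * r * z.re) (r * z.im) (by linarith) (mul_pos hr him'.1)
      ((mul_le_of_le_one_right hr.le him'.2).trans_lt hrδ)
    convert h2 using 4
    nth_rw 1 [← re_add_im z]
    push_cast
    ring
  have hPbd : ∀ a, b - s ≤ a → ∀ ξ ∈ Icc (-1 : ℝ) 1, P a ξ ∉ Ω := by
    intro a ha ξ hξ
    have h1 := (abs_le.1 (hreal _ hξ)).1
    have h2 := hbd (a + σ * r * ξ) (by linarith)
    simpa [hPdef] using h2
  have hkd : ∀ a ≤ b, DifferentiableOn ℂ (fun ζ => g (P a ζ)) (Icc (-1 : ℝ) 1 ×ℂ Ioc 0 1) :=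
    fun a ha => hgd.comp (hPd a).differentiableOn (hPΩ a ha)
  have hkbot : ∀ a, b - s ≤ a → a ≤ b → ∀ ε > 0, ∃ η > 0,
      ∀ z ∈ Icc (-1 : ℝ) 1 ×ℂ Ioc 0 1, z.im < η → 1 - ε < ‖g (P a z)‖ :=
    fun a ha ha' ε hε => exists_forall_im_lt_norm hh.continuousOn him (fun u hu => (hgΩ u hu).2)
      (hPd a).continuous (hPΩ a ha') (hPbd a ha) hε
  have hab : b - s ≤ b := by linarith
  obtain ⟨C, hC, hCle⟩ := exists_one_sub_norm_le_mul (hkd (b - s) hab) (fun z hz hz0 => by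
    have h1 := (hgΩ _ (hPΩ _ hab z hz)).2
    rw [hz0, h0] at h1
    exact mul_ne_zero hw (Complex.exp_ne_zero _) h1.symm) (hkbot _ le_rfl hab)
  obtain ⟨m, hm, hmle⟩ := exists_mul_le_one_sub_norm (hkd b le_rfl)
    fun z hz => mem_ball_zero_iff.1 (hgΩ _ (hPΩ _ le_rfl z hz)).1
  set y : ℕ → ℝ := fun n => 1 / ((n + 1 : ℕ) + 1 : ℝ) with hy
  have hy0 : ∀ n, 0 < y n := fun n => by simp only [hy]; positivity
  have hy2 : ∀ n, y n ≤ 1 / 2 := fun n => by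
    simp only [hy]
    apply one_div_le_one_div_of_le two_pos
    push_cast
    linarith [n.cast_nonneg (α := ℝ)]
  have hylim : Tendsto y atTop (𝓝 0) :=
    (tendsto_add_atTop_iff_nat 1).2 (tendsto_one_div_add_atTop_nhds_zero_nat (𝕜 := ℝ))
  have hmem : ∀ n, (y n * I : ℂ) ∈ Icc (-1 : ℝ) 1 ×ℂ Ioc 0 1 := fun n => by
    rw [mem_reProdIm]
    have := hy2 n
    simp only [mul_re, ofReal_re, I_re, mul_zero, ofReal_im, I_im, mul_one, sub_self, mul_im,
      add_zero, mem_Icc, mem_Ioc]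
    exact ⟨by norm_num, hy0 n, by linarith⟩
  have hzD : ∀ n, g (P b (y n * I)) ∈ uDisc := fun n => (hgΩ _ (hPΩ _ le_rfl _ (hmem n))).1
  refine hrep.not_compact hβ (z := fun n => g (P b (y n * I))) (C := C / m) hzD ?_ fun n => ?_
  · rw [Metric.tendsto_nhds]
    intro ε hε
    obtain ⟨η, hη, hlt⟩ := hkbot b hab le_rfl ε hε
    filter_upwards [hylim.eventually_lt_const hη] with n hn
    have h1 := hlt _ (hmem n) (by simpa using hn)
    have h2 := mem_ball_zero_iff.1 (hzD n)
    rw [Real.dist_eq, abs_sub_lt_iff]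
    constructor <;> linarith
  · have h1 : φ (g (P b (y n * I))) = g (P (b - s) (y n * I)) := by
      refine hinj (hrep.2.1 (hzD n)) (hgΩ _ (hPΩ _ hab _ (hmem n))).1 ?_
      rw [hmodel _ (hzD n), (hgΩ _ (hPΩ _ le_rfl _ (hmem n))).2,
        (hgΩ _ (hPΩ _ hab _ (hmem n))).2]
      simp only [hPdef]
      rw [mul_left_comm, ← Complex.exp_add]
      congr 2
      push_cast
      ring
    rw [h1]
    have h2 := hCle (y n) ⟨hy0 n, (hy2 n).trans (by norm_num)⟩
    have h3 := hmle (y n) ⟨hy0 n, hy2 n⟩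
    refine h2.trans ?_
    rw [div_mul_eq_mul_div, le_div_iff₀ hm, mul_assoc, mul_comm (y n)]
    exact mul_le_mul_of_nonneg_left h3 hC.le

section Model

variable {φ h : ℂ → ℂ} {c : ℂ} {t : ℝ}

lemma ne_zero_of_supNormLtOne (hmaps : MapsTo φ uDisc uDisc) (hinj : InjOn h uDisc)
    (hmodel : ∀ z ∈ uDisc, h (φ z) = Complex.exp (-(c * (t : ℂ))) * h z)
    (hφ : SupNormLtOne φ) : c ≠ 0 := by
  rintro rfl
  obtain ⟨r, hr1, hr⟩ := hφ
  have hr0 : 0 ≤ r := (norm_nonneg _).trans (hr 0 (mem_ball_self zero_lt_one))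
  have hz : (((r + 1) / 2 : ℝ) : ℂ) ∈ uDisc := by
    rw [uDisc, mem_ball_zero_iff, norm_real, Real.norm_of_nonneg (by linarith)]
    linarith
  have h1 := hr _ hz
  have h2 := hmodel _ hz
  rw [zero_mul, neg_zero, Complex.exp_zero, one_mul] at h2
  rw [hinj (hmaps hz) hz h2, norm_real, Real.norm_of_nonneg (by linarith)] at h1
  linarith

lemma exists_norm_le_of_supNormLtOne (hh : ContinuousOn h uDisc)
    (hmodel : ∀ z ∈ uDisc, h (φ z) = Complex.exp (-(c * (t : ℂ))) * h z)
    (hφ : SupNormLtOne φ) : ∃ R, ∀ z ∈ uDisc, ‖h z‖ ≤ R := by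
  obtain ⟨r, hr1, hr⟩ := hφ
  obtain ⟨M, hM⟩ := (isCompact_closedBall (0 : ℂ) r).exists_bound_of_continuousOn
    (hh.mono (closedBall_subset_ball hr1))
  refine ⟨‖Complex.exp (c * t)‖ * M, fun z hz => ?_⟩
  have h1 : h z = Complex.exp (c * t) * h (φ z) := by
    rw [hmodel z hz, ← mul_assoc, ← Complex.exp_add, add_neg_cancel, Complex.exp_zero, one_mul]
  rw [h1, norm_mul]
  exact mul_le_mul_of_nonneg_left (hM _ (mem_closedBall_zero_iff.2 (hr z hz))) (norm_nonneg _)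

/-- If the symbol has supremum norm one and `h` is bounded, some sequence in `Ω` converges to a
point which the flow has not moved into `Ω` by time `t`. -/
lemma exists_tendsto_of_not_supNormLtOne {Ω : Set ℂ} (hΩ : IsOpen Ω)
    (hh : DifferentiableOn ℂ h uDisc) (hinj : InjOn h uDisc) (him : h '' uDisc = Ω)
    (hmaps : MapsTo φ uDisc uDisc)
    (hmodel : ∀ z ∈ uDisc, h (φ z) = Complex.exp (-(c * (t : ℂ))) * h z) {R : ℝ}
    (hR : ∀ z ∈ uDisc, ‖h z‖ ≤ R) (hφ : ¬ SupNormLtOne φ) :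
    ∃ (u : ℕ → ℂ) (w : ℂ), (∀ n, u n ∈ Ω) ∧ Tendsto u atTop (𝓝 w) ∧
      Complex.exp (-(c * (t : ℂ))) * w ∉ Ω := by
  obtain ⟨g, hgd, hgh⟩ := exists_holomorphic_inverse hh hinj
  rw [him] at hgd
  have hex : ∀ n : ℕ, ∃ z ∈ uDisc, 1 - 1 / ((n : ℝ) + 1) < ‖φ z‖ := by
    intro n
    by_contra! hle
    exact hφ ⟨_, by simp; positivity, hle⟩
  choose z hzD hz using hex
  obtain ⟨w, -, ψ, hψ, hlim⟩ := (isCompact_closedBall (0 : ℂ) R).tendsto_subseq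
    (fun n => mem_closedBall_zero_iff.2 (hR _ (hzD n)))
  refine ⟨_, w, fun n => him ▸ mem_image_of_mem h (hzD (ψ n)), hlim, fun hmem => ?_⟩
  have h1 : Tendsto (fun n => φ (z (ψ n))) atTop (𝓝 (g (Complex.exp (-(c * (t : ℂ))) * w))) := by
    have h2 := ((hgd.differentiableAt (hΩ.mem_nhds hmem)).continuousAt.tendsto).comp
      (hlim.const_mul (Complex.exp (-(c * (t : ℂ)))))
    refine h2.congr fun n => ?_
    simp only [Function.comp_apply]
    rw [← hmodel _ (hzD _), hgh _ (hmaps (hzD _))]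
  have h3 : ‖g (Complex.exp (-(c * (t : ℂ))) * w)‖ < 1 := by
    obtain ⟨v, hv, hv'⟩ := him ▸ hmem
    rw [← hv', hgh v hv]
    exact mem_ball_zero_iff.1 hv
  have h4 : Tendsto (fun n : ℕ => 1 - 1 / ((ψ n : ℝ) + 1)) atTop (𝓝 (1 - 0)) :=
    ((tendsto_one_div_add_atTop_nhds_zero_nat (𝕜 := ℝ)).comp hψ.tendsto_atTop).const_sub 1
  have h5 := le_of_tendsto_of_tendsto' h4 h1.norm fun n => (hz (ψ n)).le
  linarith

end Model

/-- Points of `Ω` accumulating at `w`, seen in the logarithmic coordinate along the flow line of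
`w`, accumulate from one of its two sides. -/
lemma exists_side {Ω : Set ℂ} {c w : ℂ} (hc : c ≠ 0) (hw : w ≠ 0) {u : ℕ → ℂ}
    (hu : ∀ n, u n ∈ Ω) (hlim : Tendsto u atTop (𝓝 w)) {a : ℝ} (ha : a < 0)
    (hbd : ∀ x : ℝ, a < x → w * Complex.exp (c * x) ∉ Ω) :
    ∃ σ : ℝ, (σ = 1 ∨ σ = -1) ∧ ∀ ε > 0, ∃ x y : ℝ, a < x ∧ 0 < y ∧ y < ε ∧
      w * Complex.exp (c * (x + σ * y * I)) ∈ Ω := by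
  set ζ : ℕ → ℂ := fun n => Complex.log (u n / w) / c with hζ
  have hquot : Tendsto (fun n => u n / w) atTop (𝓝 1) := by
    simpa [div_self hw] using hlim.div_const w
  have hζlim : Tendsto ζ atTop (𝓝 0) := by
    have h1 := (continuousAt_clog one_mem_slitPlane).tendsto.comp hquot
    simpa using h1.div_const c
  have hζΩ : ∀ᶠ n in atTop, w * Complex.exp (c * ζ n) ∈ Ω := by
    filter_upwards [hquot.eventually_ne one_ne_zero] with n hn
    rw [hζ, mul_div_cancel₀ _ hc, Complex.exp_log hn, mul_div_cancel₀ _ hw]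
    exact hu n
  have hnear : ∀ ε > 0, ∃ x y : ℝ, a < x ∧ y ≠ 0 ∧ |y| < ε ∧
      w * Complex.exp (c * (x + y * I)) ∈ Ω := by
    intro ε hε
    obtain ⟨n, hn1, hn2⟩ := (hζΩ.and ((Metric.tendsto_nhds.1 hζlim) (min ε (-a))
      (lt_min hε (by linarith)))).exists
    rw [dist_zero_right, lt_min_iff] at hn2
    have h1 := (abs_re_le_norm (ζ n)).trans_lt hn2.2
    have h2 := (abs_im_le_norm (ζ n)).trans_lt hn2.1
    have h3 : a < (ζ n).re := by linarith [(abs_lt.1 h1).1]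
    refine ⟨(ζ n).re, (ζ n).im, h3, fun hy => ?_, h2, by rwa [re_add_im]⟩
    refine hbd _ h3 ?_
    rwa [← re_add_im (ζ n), hy, ofReal_zero, zero_mul, add_zero] at hn1
  by_cases hpos : ∀ ε > 0, ∃ x y : ℝ, a < x ∧ 0 < y ∧ y < ε ∧
      w * Complex.exp (c * (x + (1 : ℝ) * y * I)) ∈ Ω
  · exact ⟨1, .inl rfl, hpos⟩
  · refine ⟨-1, .inr rfl, fun ε hε => ?_⟩
    push Not at hpos
    obtain ⟨ε₁, hε₁, hnot⟩ := hpos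
    obtain ⟨x, y, hx, hy0, hy, hmem⟩ := hnear (min ε ε₁) (lt_min hε hε₁)
    rw [lt_min_iff] at hy
    rcases hy0.lt_or_gt with hneg | hpos
    · refine ⟨x, -y, hx, by linarith, by rw [← abs_of_neg hneg]; exact hy.1, ?_⟩
      simpa using hmem
    · refine absurd ?_ (hnot x y hx hpos ((le_abs_self y).trans_lt hy.2))
      simpa using hmem
/-- For an immediately compact semigroup of composition operators
on `H²(𝔻)` or `𝒟` whose semiflow model domain `Ω` has locally connected boundary:
`‖φ_{t₀}‖_∞ < 1` for some `t₀ > 0` iff `‖φ_t‖_∞ < 1` for all `t > 0`; and in that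
case the semigroup is immediately trace-class. -/
theorem statement14 (β : ℕ → ℝ) (hβ : β = hardyW ∨ β = dirichletW)
    (φ : ℝ → ℂ → ℂ) (hφ : IsSemiflow φ)
    (T : ℝ → WH2 →L[ℂ] WH2) (hT : IsC0Semigroup T)
    (hrep : ∀ t : ℝ, 0 ≤ t → RepresentsComp β (T t) (φ t))
    (hcomp : ImmediatelyCompact T)
    (c : ℂ) (hc : 0 ≤ c.re) (Ω : Set ℂ) (hΩ : IsOpen Ω) (h : ℂ → ℂ)
    (hh : DifferentiableOn ℂ h uDisc) (hinj : InjOn h uDisc)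
    (him : h '' uDisc = Ω) (h0 : h 0 = 0)
    (hspiral : ∀ w ∈ Ω, ∀ t : ℝ, 0 ≤ t → Complex.exp (-(c * (t : ℂ))) * w ∈ Ω)
    (hmodel : ∀ t : ℝ, 0 ≤ t → ∀ z ∈ uDisc,
      h (φ t z) = Complex.exp (-(c * (t : ℂ))) * h z)
    (hlc : LocallyConnectedSpace (frontier Ω)) :
    ((∃ t₀ : ℝ, 0 < t₀ ∧ SupNormLtOne (φ t₀)) ↔
        ∀ t : ℝ, 0 < t → SupNormLtOne (φ t)) ∧
      ((∃ t₀ : ℝ, 0 < t₀ ∧ SupNormLtOne (φ t₀)) →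
        ∀ t : ℝ, 0 < t → IsTraceClass (T t)) := by
  have hall : (∃ t₀ : ℝ, 0 < t₀ ∧ SupNormLtOne (φ t₀)) → ∀ t : ℝ, 0 < t → SupNormLtOne (φ t) := by
    rintro ⟨t₀, ht₀, hsup⟩ t ht
    by_contra hnot
    have hmaps := fun t ht => (hφ.2.1 t ht).2
    have hc0 := ne_zero_of_supNormLtOne (hmaps t₀ ht₀.le) hinj (hmodel t₀ ht₀.le) hsup
    obtain ⟨R, hR⟩ := exists_norm_le_of_supNormLtOne hh.continuousOn (hmodel t₀ ht₀.le) hsup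
    obtain ⟨u, w, hu, hlim, hout⟩ := exists_tendsto_of_not_supNormLtOne hΩ hh hinj him
      (hmaps t ht.le) (hmodel t ht.le) hR hnot
    have hw : w ≠ 0 := by
      rintro rfl
      rw [mul_zero, ← h0] at hout
      exact hout (him ▸ mem_image_of_mem h (mem_ball_self zero_lt_one))
    have hbd : ∀ x : ℝ, -t ≤ x → w * Complex.exp (c * x) ∉ Ω := by
      intro x hx hmem
      refine hout ?_
      convert hspiral _ hmem (x + t) (by linarith) using 1
      rw [mul_left_comm, ← Complex.exp_add, mul_comm]
      congr 2
      push_cast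
      ring
    have hfront : w * Complex.exp (c * ((-t / 4 : ℝ) : ℂ)) ∈ frontier Ω := by
      rw [frontier, hΩ.interior_eq]
      refine ⟨?_, hbd _ (by linarith)⟩
      have h1 := mem_closure_of_tendsto
        (hlim.const_mul (Complex.exp (-(c * ((t / 4 : ℝ) : ℂ)))))
        (Eventually.of_forall fun n => hspiral _ (hu n) (t / 4) (by linarith))
      convert h1 using 1
      rw [mul_comm]
      congr 2
      push_cast
      ring
    obtain ⟨σ, hσ, hacc⟩ := exists_side hc0 hw hu hlim (a := -t / 4 + t / 8) (by linarith)
      fun x hx => hbd x (by linarith)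
    obtain ⟨δ, hδ, hstrip⟩ := exists_strip_subset hΩ hlc hc0 hw hspiral hfront hσ hacc
      (by linarith)
    have hr1 : min (t / 4) (δ / 2) ≤ t / 4 := min_le_left _ _
    have hr2 : min (t / 4) (δ / 2) ≤ δ / 2 := min_le_right _ _
    refine (hrep (t / 4) (by linarith)).not_compact_of_strip hβ hh hinj him h0
      (hmodel (t / 4) (by linarith)) hw hσ (r := min (t / 4) (δ / 2)) (b := -t / 2) (δ := δ)
      (by linarith) (lt_min (by linarith) (by linarith)) (by linarith)
      (fun x y hx => hstrip x y (by linarith)) (fun x hx => hbd x (by linarith))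
      (hcomp (t / 4) (by linarith))
  refine ⟨⟨hall, fun hsup => ⟨1, one_pos, hsup 1 one_pos⟩⟩, fun hsup t ht => ?_⟩
  have ht2 : 0 < t / 2 := by linarith
  have hHS := (hrep (t / 2) ht2.le).isHilbertSchmidt hβ (hall hsup (t / 2) ht2)
  refine ⟨T (t / 2), T (t / 2), hHS, hHS, ?_⟩
  rw [← hT.2.1 _ _ ht2.le ht2.le, add_halves]
end

section
/- Let G be holomorphic on the right half-plane ℂ₊ and let A be the operator Af = G·f′ with domain D(A) ⊂ H²(ℂ₊). If A generates a quasicontractive C₀-semigroup on H²(ℂ₊), then inf_{w∈ℂ₊} Re G(w)/Re w > −∞; and if the semigroup is contractive, then Re G(w)/Re w ≥ 0 for all w ∈ ℂ₊. -/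
open Complex MeasureTheory Filter Set Metric
open scoped Real Topology ENNReal

noncomputable section

/-- The right half-plane `ℂ₊`. -/
def rightHP : Set ℂ := {z : ℂ | 0 < z.re}

/-- The Hardy space `H²(ℂ₊)` of the right half-plane, modeled (via the Paley–Wiener
theorem) as `L²(0,∞)`: the function `f(z) = ∫₀^∞ F(s) e^{-sz} ds` corresponds to
`F ∈ L²(0,∞)`. -/
abbrev HP2 : Type := MeasureTheory.Lp ℂ 2 (volume.restrict (Set.Ioi (0 : ℝ)))

/-- The holomorphic function on `ℂ₊` associated to an element of `H²(ℂ₊)`. -/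
def hpToFun (F : HP2) (z : ℂ) : ℂ :=
  ∫ s in Set.Ioi (0 : ℝ), F s * Complex.exp (-(s : ℂ) * z)

/-- `T` acts as the composition operator with analytic self-map symbol `φ` on `H²(ℂ₊)`. -/
def RepresentsCompHP (T : HP2 →L[ℂ] HP2) (φ : ℂ → ℂ) : Prop :=
  DifferentiableOn ℂ φ rightHP ∧ MapsTo φ rightHP rightHP ∧
  ∀ F : HP2, ∀ z ∈ rightHP, hpToFun (T F) z = hpToFun F (φ z)

/-- The natural domain of `A f = G f'` in `H²(ℂ₊)`. -/
def domAhp (G : ℂ → ℂ) : Set HP2 :=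
  {F : HP2 | ∃ g : HP2, ∀ z ∈ rightHP, hpToFun g z = G z * deriv (hpToFun F) z}

open Classical in
/-- The operator `A f = G f'` on `H²(ℂ₊)` (via choice on its natural domain). -/
def opAhp (G : ℂ → ℂ) (F : HP2) : HP2 :=
  if h : F ∈ domAhp G then h.choose else 0

end

section SemigroupLemmas

variable {X : Type*} [NormedAddCommGroup X] [NormedSpace ℂ X]

/-- The orbits of a quasicontractive `C₀`-semigroup, frozen at negative times, are continuous. -/
theorem IsC0Semigroup.continuous_orbit {T : ℝ → X →L[ℂ] X} (hT : IsC0Semigroup T) {ω : ℝ}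
    (hω : 0 ≤ ω) (hb : ∀ t : ℝ, 0 ≤ t → ‖T t‖ ≤ Real.exp (ω * t)) (x : X) :
    Continuous fun t : ℝ => T (max t 0) x := by
  obtain ⟨h0, hadd, hlim⟩ := hT
  have key : ∀ s t : ℝ, 0 ≤ s → s ≤ t →
      ‖T t x - T s x‖ ≤ Real.exp (ω * t) * ‖T |t - s| x - x‖ := by
    intro s t hs hst
    have h1 : T t x - T s x = T s (T (t - s) x - x) := by
      have h2 := hadd s (t - s) hs (sub_nonneg.2 hst)
      rw [add_sub_cancel] at h2
      rw [h2, map_sub]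
      rfl
    rw [h1, abs_of_nonneg (sub_nonneg.2 hst)]
    refine ((T s).le_opNorm _).trans ?_
    gcongr
    exact (hb s hs).trans (by gcongr)
  refine continuous_iff_continuousAt.2 fun a => ?_
  rw [ContinuousAt, tendsto_iff_norm_sub_tendsto_zero]
  have habs : Tendsto (fun t : ℝ => |max t 0 - max a 0|) (𝓝 a) (𝓝[≥] 0) := by
    refine tendsto_nhdsWithin_iff.2 ⟨?_, Eventually.of_forall fun t => mem_Ici.2 (abs_nonneg _)⟩
    have : Continuous fun t : ℝ => |max t 0 - max a 0| := by fun_prop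
    simpa using this.tendsto a
  have h1 : Tendsto (fun t : ℝ => ‖T |max t 0 - max a 0| x - x‖) (𝓝 a) (𝓝 0) :=
    tendsto_iff_norm_sub_tendsto_zero.1 ((hlim x).comp habs)
  have h2 : Tendsto (fun t : ℝ => Real.exp (ω * max (max t 0) (max a 0))) (𝓝 a)
      (𝓝 (Real.exp (ω * max (max a 0) (max a 0)))) := by
    have : Continuous fun t : ℝ => Real.exp (ω * max (max t 0) (max a 0)) := by fun_prop
    exact this.tendsto a
  have h3 := h2.mul h1
  rw [mul_zero] at h3
  refine squeeze_zero (fun _ => norm_nonneg _) (fun t => ?_) h3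
  rcases le_total (max a 0) (max t 0) with h | h
  · rw [max_eq_left h]
    exact key _ _ (le_max_right _ _) h
  · rw [max_eq_right h, norm_sub_rev, abs_sub_comm]
    exact key _ _ (le_max_right _ _) h

/-- The integrals `∫₀ʰ T(r) x dr` lie in the domain of the generator, which sends them to
`T(h) x - x`, and their averages converge to `x`. -/
theorem IsC0Semigroup.exists_genLimit [CompleteSpace X] {T : ℝ → X →L[ℂ] X}
    (hT : IsC0Semigroup T) {ω : ℝ} (hω : 0 ≤ ω)
    (hb : ∀ t : ℝ, 0 ≤ t → ‖T t‖ ≤ Real.exp (ω * t)) (x : X) :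
    ∃ y : ℝ → X, (∀ h : ℝ, 0 < h → GenLimit T (y h) (T h x - x)) ∧
      Tendsto (fun h : ℝ => (h : ℂ)⁻¹ • y h) (𝓝[>] 0) (𝓝 x) := by
  have hu := hT.continuous_orbit hω hb x
  obtain ⟨h0, hadd, -⟩ := hT
  set u : ℝ → X := fun t => T (max t 0) x with hu_def
  have hu0 : u 0 = x := by simp [hu_def, h0]
  have hint : ∀ a b : ℝ, IntervalIntegrable u volume a b := fun a b => hu.intervalIntegrable a b
  have hP : ∀ b : ℝ, HasDerivAt (fun t : ℝ => ∫ r in (0 : ℝ)..t, u r) (u b) b := fun b =>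
    intervalIntegral.integral_hasDerivAt_right (hint 0 b)
      hu.stronglyMeasurable.stronglyMeasurableAtFilter hu.continuousAt
  have hsmul : ∀ (t : ℝ) (v : X), (t : ℂ)⁻¹ • v = t⁻¹ • v := fun t v => by
    rw [← ofReal_inv]; exact Complex.coe_smul _ _
  refine ⟨fun h => ∫ r in (0 : ℝ)..h, u r, fun h hh => ?_, ?_⟩
  · have hd : HasDerivAt (fun t : ℝ => (∫ r in (0 : ℝ)..(t + h), u r) - ∫ r in (0 : ℝ)..t, u r)
        (u h - u 0) 0 :=
      (HasDerivAt.comp_add_const 0 h (by simpa using hP h)).sub (hP 0)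
    have hs := hd.tendsto_slope_zero_right
    have huh : u h = T h x := by simp [hu_def, hh.le]
    rw [hu0, huh] at hs
    refine hs.congr' ?_
    filter_upwards [self_mem_nhdsWithin] with t (ht : 0 < t)
    rw [hsmul]
    congr 1
    have hTt : T t (∫ r in (0 : ℝ)..h, u r) = ∫ r in t..(t + h), u r := by
      rw [← ContinuousLinearMap.intervalIntegral_comp_comm _ (hint 0 h)]
      have : ∫ r in (0 : ℝ)..h, T t (u r) = ∫ r in (0 : ℝ)..h, u (t + r) := by
        refine intervalIntegral.integral_congr fun r hr => ?_
        rw [uIcc_of_le hh.le] at hr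
        have h1 := hadd t r ht.le hr.1
        simp only [hu_def]
        rw [max_eq_left hr.1, max_eq_left (add_nonneg ht.le hr.1), h1]
        rfl
      rw [this, intervalIntegral.integral_comp_add_left (fun r => u r), add_zero]
    rw [hTt, ← intervalIntegral.integral_interval_sub_left (hint 0 (t + h)) (hint 0 t)]
    simp
  · have hs := (hP 0).tendsto_slope_zero_right
    rw [hu0] at hs
    refine hs.congr fun t => ?_
    rw [hsmul]
    simp

end SemigroupLemmas

section Hardy

/-- Polynomial moments of a decaying exponential converge on the half-line. -/
theorem integrableOn_pow_mul_exp_neg (n : ℕ) {b : ℝ} (hb : 0 < b) :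
    IntegrableOn (fun s : ℝ => s ^ n * Real.exp (-(b * s))) (Ioi 0) := by
  have := integrableOn_rpow_mul_exp_neg_mul_rpow (p := 1) (s := n) (b := b)
    (lt_of_lt_of_le (by norm_num) n.cast_nonneg) one_pos hb
  simpa [neg_mul] using this

theorem norm_pow_mul_cexp (n : ℕ) (w : ℂ) {s : ℝ} (hs : 0 < s) :
    ‖(s : ℂ) ^ n * Complex.exp (-(s : ℂ) * w)‖ = s ^ n * Real.exp (-(s * w.re)) := by
  rw [norm_mul, Complex.norm_exp, norm_pow, Complex.norm_real, Real.norm_of_nonneg hs.le]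
  simp

theorem memLp_pow_mul_cexp (n : ℕ) {w : ℂ} (hw : 0 < w.re) :
    MemLp (fun s : ℝ => (s : ℂ) ^ n * Complex.exp (-(s : ℂ) * w)) 2
      (volume.restrict (Ioi (0 : ℝ))) := by
  have hc : Continuous fun s : ℝ => (s : ℂ) ^ n * Complex.exp (-(s : ℂ) * w) := by fun_prop
  refine (memLp_two_iff_integrable_sq_norm hc.aestronglyMeasurable).2 ?_
  refine (integrableOn_pow_mul_exp_neg (2 * n) (b := 2 * w.re) (by positivity)).congr_fun
    (fun s (hs : 0 < s) => ?_) measurableSet_Ioi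
  simp only
  rw [norm_pow_mul_cexp n w hs, mul_pow, ← pow_mul, mul_comm n 2, ← Real.exp_nat_mul]
  congr 2
  push_cast
  ring

/-- The element of `H²(ℂ₊)` whose inner product with `F` is `∫ F(s) sⁿ e^{-sw} ds`. -/
noncomputable def momentKernel (n : ℕ) {w : ℂ} (hw : 0 < w.re) : HP2 :=
  (memLp_pow_mul_cexp n hw).star.toLp _

theorem coeFn_momentKernel (n : ℕ) {w : ℂ} (hw : 0 < w.re) :
    momentKernel n hw =ᵐ[volume.restrict (Ioi (0 : ℝ))]
      fun s : ℝ => star ((s : ℂ) ^ n * Complex.exp (-(s : ℂ) * w)) :=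
  (memLp_pow_mul_cexp n hw).star.coeFn_toLp

theorem inner_momentKernel (n : ℕ) {w : ℂ} (hw : 0 < w.re) (F : HP2) :
    inner ℂ (momentKernel n hw) F =
      ∫ s in Ioi (0 : ℝ), F s * ((s : ℂ) ^ n * Complex.exp (-(s : ℂ) * w)) := by
  rw [L2.inner_def]
  refine integral_congr_ae ?_
  filter_upwards [coeFn_momentKernel n hw] with s hs
  rw [hs, RCLike.inner_apply]
  simp

theorem hpToFun_eq_inner {w : ℂ} (hw : 0 < w.re) (F : HP2) :
    hpToFun F w = inner ℂ (momentKernel 0 hw) F := by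
  rw [inner_momentKernel]
  simp [hpToFun]

theorem inner_momentKernel_momentKernel_zero (n : ℕ) {w : ℂ} (hw : 0 < w.re) :
    inner ℂ (momentKernel n hw) (momentKernel 0 hw) =
      ((n.factorial / (2 * w.re) ^ (n + 1) : ℝ) : ℂ) := by
  rw [inner_momentKernel]
  have h := Real.integral_rpow_mul_exp_neg_mul_Ioi (a := n + 1) (r := 2 * w.re)
    (by positivity) (by positivity)
  rw [Real.Gamma_nat_eq_factorial] at h
  have h' : (n.factorial / (2 * w.re) ^ (n + 1) : ℝ) =
      ∫ s in Ioi (0 : ℝ), s ^ ((n : ℝ) + 1 - 1) * Real.exp (-(2 * w.re * s)) := by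
    rw [h]
    have : (1 / (2 * w.re)) ^ ((n : ℝ) + 1) = (1 / (2 * w.re)) ^ (n + 1) := by
      exact_mod_cast Real.rpow_natCast (1 / (2 * w.re)) (n + 1)
    rw [this, div_pow, one_pow]
    ring
  rw [h', ← integral_complex_ofReal]
  refine integral_congr_ae ?_
  filter_upwards [coeFn_momentKernel 0 hw, ae_restrict_mem measurableSet_Ioi] with s hs _
  rw [hs]
  have e : star (Complex.exp (-(s : ℂ) * w)) * Complex.exp (-(s : ℂ) * w) =
      Complex.exp (-(2 * w.re * s)) := by
    rw [Complex.star_def, ← Complex.exp_conj, ← Complex.exp_add]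
    congr 1
    apply Complex.ext <;> simp; ring
  rw [pow_zero, one_mul, add_sub_cancel_right, Real.rpow_natCast]
  push_cast
  rw [← e]
  ring

theorem integrable_mul_pow_mul_cexp (n : ℕ) {w : ℂ} (hw : 0 < w.re) (F : HP2) :
    Integrable (fun s : ℝ => F s * ((s : ℂ) ^ n * Complex.exp (-(s : ℂ) * w)))
      (volume.restrict (Ioi (0 : ℝ))) :=
  (Lp.memLp F).integrable_mul (memLp_pow_mul_cexp n hw)

theorem deriv_hpToFun {w : ℂ} (hw : 0 < w.re) (F : HP2) :
    deriv (hpToFun F) w = -inner ℂ (momentKernel 1 hw) F := by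
  have hw2 : 0 < ((w.re / 2 : ℝ) : ℂ).re := by rw [ofReal_re]; positivity
  have h := hasDerivAt_integral_of_dominated_loc_of_deriv_le
    (μ := volume.restrict (Ioi (0 : ℝ)))
    (F := fun (z : ℂ) (s : ℝ) => F s * Complex.exp (-(s : ℂ) * z))
    (F' := fun (z : ℂ) (s : ℝ) => F s * (Complex.exp (-(s : ℂ) * z) * -(s : ℂ)))
    (x₀ := w) (s := ball w (w.re / 2))
    (bound := fun s : ℝ =>
      ‖F s * ((s : ℂ) ^ 1 * Complex.exp (-(s : ℂ) * ((w.re / 2 : ℝ) : ℂ)))‖)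
    (ball_mem_nhds w (by positivity)) ?_ ?_ ?_ ?_ ?_ ?_
  · rw [inner_momentKernel, ← integral_neg]
    refine h.2.deriv.trans (integral_congr_ae (Eventually.of_forall fun s => ?_))
    simp only
    ring
  · refine Eventually.of_forall fun z => ?_
    exact (Lp.aestronglyMeasurable F).mul (Continuous.aestronglyMeasurable (by fun_prop))
  · simpa using integrable_mul_pow_mul_cexp 0 hw F
  · exact (Lp.aestronglyMeasurable F).mul (Continuous.aestronglyMeasurable (by fun_prop))
  · filter_upwards [ae_restrict_mem measurableSet_Ioi] with s (hs : 0 < s) z hz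
    have hre : w.re / 2 ≤ z.re := by
      have h1 := (Complex.abs_re_le_norm (z - w)).trans_lt (mem_ball_iff_norm.1 hz)
      rw [sub_re] at h1
      linarith [(abs_lt.1 h1).1]
    rw [norm_mul, norm_mul (F s), norm_pow_mul_cexp 1 _ hs]
    have : Complex.exp (-(s : ℂ) * z) * -(s : ℂ) =
        -((s : ℂ) ^ 1 * Complex.exp (-(s : ℂ) * z)) := by ring
    rw [this, norm_neg, norm_pow_mul_cexp 1 _ hs, ofReal_re]
    gcongr
  · exact (integrable_mul_pow_mul_cexp 1 hw2 F).norm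
  · refine Eventually.of_forall fun s z _ => ?_
    have h1 : HasDerivAt (fun z : ℂ => -(s : ℂ) * z) (-(s : ℂ)) z := by
      simpa using (hasDerivAt_id z).const_mul (-(s : ℂ))
    exact h1.cexp.const_mul (F s)

theorem hpToFun_opAhp {G : ℂ → ℂ} {F : HP2} (hF : F ∈ domAhp G) {z : ℂ} (hz : z ∈ rightHP) :
    hpToFun (opAhp G F) z = G z * deriv (hpToFun F) z := by
  rw [opAhp, dif_pos hF]
  exact hF.choose_spec z hz

/-- If `A f = G f'` generates a semigroup of growth bound `ω`, then `Re G(w) ≥ -2 ω Re w`. -/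
theorem neg_two_mul_le_re_div_re {G : ℂ → ℂ} {T : ℝ → HP2 →L[ℂ] HP2} (hT : IsC0Semigroup T)
    (hgen : IsGenerator T (domAhp G) (opAhp G)) {ω : ℝ} (hω : 0 ≤ ω)
    (hb : ∀ t : ℝ, 0 ≤ t → ‖T t‖ ≤ Real.exp (ω * t)) {w : ℂ} (hw : 0 < w.re) :
    -(2 * ω) ≤ (G w).re / w.re := by
  set k : HP2 := momentKernel 0 hw with hk
  set d : HP2 := momentKernel 1 hw with hd
  obtain ⟨y, hy, hylim⟩ := hT.exists_genLimit hω hb k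
  have hA : ∀ h : ℝ, 0 < h → inner ℂ k (T h k - k) = G w * -inner ℂ d (y h) := by
    intro h hh
    have hmem := hgen.2 _ ⟨_, hy h hh⟩
    rw [← deriv_hpToFun hw, ← hpToFun_opAhp hmem hw, hpToFun_eq_inner hw,
      tendsto_nhds_unique (hgen.1 _ hmem) (hy h hh)]
  have hlim : Tendsto (fun h : ℝ => ((h : ℂ)⁻¹ * inner ℂ k (T h k - k)).re) (𝓝[>] 0)
      (𝓝 (G w * -inner ℂ d k).re) := by
    have h1 : Tendsto (fun h : ℝ => (G w * -inner ℂ d ((h : ℂ)⁻¹ • y h)).re) (𝓝[>] 0)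
        (𝓝 (G w * -inner ℂ d k).re) := by
      have hc : Continuous fun v : HP2 => (G w * -inner ℂ d v).re := by fun_prop
      exact (hc.tendsto k).comp hylim
    refine h1.congr' ?_
    filter_upwards [self_mem_nhdsWithin] with h hh
    rw [hA h hh, inner_smul_right]
    congr 1
    ring
  have hexp : Tendsto (fun h : ℝ => h⁻¹ * (Real.exp (ω * h) - 1) * ‖k‖ ^ 2) (𝓝[>] 0)
      (𝓝 (ω * ‖k‖ ^ 2)) := by
    have h1 : HasDerivAt (fun h : ℝ => Real.exp (ω * h)) ω 0 := by
      simpa using ((hasDerivAt_id (0 : ℝ)).const_mul ω).exp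
    have h2 := h1.tendsto_slope_zero_right
    simp only [zero_add, mul_zero, Real.exp_zero, smul_eq_mul] at h2
    exact h2.mul_const _
  have hle : (G w * -inner ℂ d k).re ≤ ω * ‖k‖ ^ 2 := by
    refine le_of_tendsto_of_tendsto hlim hexp ?_
    filter_upwards [self_mem_nhdsWithin] with h (hh : 0 < h)
    rw [← ofReal_inv, re_ofReal_mul, mul_assoc]
    have h1 : (inner ℂ k (T h k)).re ≤ Real.exp (ω * h) * ‖k‖ ^ 2 := by
      calc (inner ℂ k (T h k)).re ≤ ‖k‖ * ‖T h k‖ := re_inner_le_norm (𝕜 := ℂ) _ _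
        _ ≤ ‖k‖ * (Real.exp (ω * h) * ‖k‖) := by
          gcongr
          exact (T h).le_of_opNorm_le (hb h hh.le) k
        _ = Real.exp (ω * h) * ‖k‖ ^ 2 := by ring
    have h2 : (inner ℂ k k).re = ‖k‖ ^ 2 := inner_self_eq_norm_sq (𝕜 := ℂ) k
    gcongr
    rw [inner_sub_right, sub_re, h2]
    linarith
  have hkk : ‖k‖ ^ 2 = 1 / (2 * w.re) := by
    rw [← inner_self_eq_norm_sq (𝕜 := ℂ) k, hk, inner_momentKernel_momentKernel_zero]
    simp
  rw [hkk, hd, hk, inner_momentKernel_momentKernel_zero, ← ofReal_neg, re_mul_ofReal] at hle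
  rw [le_div_iff₀ hw]
  have h3 := mul_le_mul_of_nonneg_right hle (by positivity : 0 ≤ (2 * w.re) ^ 2)
  norm_num at h3
  field_simp at h3
  linarith

end Hardy

/-- If `A f = G f'` generates a quasicontractive `C₀`-semigroup on
`H²(ℂ₊)`, then `inf_(w ∈ ℂ₊) Re G(w) / Re w > -∞`; if the semigroup is contractive,
then `Re G(w) / Re w ≥ 0` on `ℂ₊`. -/
theorem statement18 (G : ℂ → ℂ) (hG : DifferentiableOn ℂ G rightHP)
    (T : ℝ → HP2 →L[ℂ] HP2) (hT : IsC0Semigroup T)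
    (hgen : IsGenerator T (domAhp G) (opAhp G))
    (hqc : Quasicontractive T) :
    (∃ m : ℝ, ∀ w : ℂ, 0 < w.re → m ≤ (G w).re / w.re) ∧
      ((∀ t : ℝ, 0 ≤ t → ‖T t‖ ≤ 1) →
        ∀ w : ℂ, 0 < w.re → 0 ≤ (G w).re / w.re) := by
  refine ⟨?_, fun hc w hw => ?_⟩
  · obtain ⟨ω, hω, hb⟩ := hqc
    exact ⟨-(2 * ω), fun w hw => neg_two_mul_le_re_div_re hT hgen hω hb hw⟩
  · simpa using neg_two_mul_le_re_div_re hT hgen le_rfl (by simpa using hc) hw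
end

section
/- Suppose A : f ↦ G·f′ generates a quasicontractive C₀-group of bounded composition operators on H²(ℂ₊). Then G(z) = pz + iq for some real constants p and q, and consequently the associated flow is φ_t(z) = z e^{pt} + (iq/p)(e^{pt} − 1) for all t ∈ ℝ, z ∈ ℂ₊ if p ≠ 0, and φ_t(z) = z + iqt if p = 0. -/
open Complex MeasureTheory Filter Set Metric
open scoped Real Topology ENNReal

open scoped ComplexConjugate

section Kernel

theorem memLp_exp_neg_mul {a : ℂ} (ha : a ∈ rightHP) :
    MemLp (fun s : ℝ => Complex.exp (-(s : ℂ) * a)) 2 (volume.restrict (Set.Ioi (0 : ℝ))) := by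
  have ha' : 0 < a.re := ha
  rw [memLp_two_iff_integrable_sq_norm (by fun_prop)]
  have h := integrableOn_exp_mul_Ioi (a := -(2 * a.re)) (by linarith) 0
  refine h.congr (Eventually.of_forall fun s => ?_)
  simp only [Complex.norm_exp, ← Real.exp_nat_mul]
  congr 1
  simp
  ring

theorem conj_mem_rightHP {a : ℂ} (ha : a ∈ rightHP) : conj a ∈ rightHP := by
  simpa [rightHP] using ha

/-- The reproducing kernel of `H²(ℂ₊)` at a point of `ℂ₊`. -/
noncomputable def hpKernel {a : ℂ} (ha : a ∈ rightHP) : HP2 :=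
  (memLp_exp_neg_mul (conj_mem_rightHP ha)).toLp _

theorem inner_hpKernel {a : ℂ} (ha : a ∈ rightHP) (F : HP2) :
    inner ℂ (hpKernel ha) F = hpToFun F a := by
  rw [L2.inner_def, hpToFun]
  refine integral_congr_ae ?_
  filter_upwards [(memLp_exp_neg_mul (conj_mem_rightHP ha)).coeFn_toLp] with s hs
  rw [hpKernel, hs, RCLike.inner_apply, ← Complex.exp_conj]
  simp

theorem norm_hpKernel_sq {a : ℂ} (ha : a ∈ rightHP) :
    ‖hpKernel ha‖ ^ 2 = 1 / (2 * a.re) := by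
  have ha' : 0 < a.re := ha
  have h : ((‖hpKernel ha‖ ^ 2 : ℝ) : ℂ) = ((1 / (2 * a.re) : ℝ) : ℂ) := by
    push_cast
    rw [← RCLike.ofReal_eq_complex_ofReal, ← inner_self_eq_norm_sq_to_K (𝕜 := ℂ), inner_hpKernel,
      hpToFun]
    calc _ = ∫ s in Set.Ioi (0 : ℝ), Complex.exp (-(2 * a.re : ℂ) * s) := by
          refine integral_congr_ae ?_
          filter_upwards [(memLp_exp_neg_mul (conj_mem_rightHP ha)).coeFn_toLp] with s hs
          rw [hpKernel, hs, ← Complex.exp_add]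
          congr 1
          rw [← mul_add, add_comm, Complex.add_conj]
          push_cast
          ring
      _ = _ := by
          rw [integral_exp_mul_complex_Ioi (by simpa using ha')]
          simp
  exact_mod_cast h

/-- The lower bound on the real part of the symbol given by the norm of a composition operator. -/
theorem RepresentsCompHP.re_le_norm_sq_mul_re {T : HP2 →L[ℂ] HP2} {φ : ℂ → ℂ}
    (h : RepresentsCompHP T φ) {z : ℂ} (hz : z ∈ rightHP) :
    z.re ≤ ‖T‖ ^ 2 * (φ z).re := by
  have hφ := h.2.1 hz
  have hz' : 0 < z.re := hz
  have hφ' : 0 < (φ z).re := hφ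
  set k := hpKernel hφ
  have hk2 : ‖k‖ ^ 2 = 1 / (2 * (φ z).re) := norm_hpKernel_sq hφ
  have hkpos : 0 < ‖k‖ := by
    have : 0 < ‖k‖ ^ 2 := by rw [hk2]; positivity
    exact (norm_nonneg k).lt_of_ne fun h0 => by simp [← h0] at this
  have h1 : inner ℂ (hpKernel hz) (T k) = inner ℂ k k := by
    rw [inner_hpKernel, h.2.2 _ z hz, ← inner_hpKernel hφ]
  have h2 : ‖k‖ ^ 2 ≤ ‖hpKernel hz‖ * (‖T‖ * ‖k‖) := by
    calc ‖k‖ ^ 2 = ‖inner ℂ k k‖ := by rw [inner_self_eq_norm_sq_to_K]; simp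
      _ ≤ ‖hpKernel hz‖ * ‖T k‖ := by rw [← h1]; exact norm_inner_le_norm _ _
      _ ≤ _ := by gcongr; exact T.le_opNorm k
  have h3 : ‖k‖ ≤ ‖hpKernel hz‖ * ‖T‖ :=
    le_of_mul_le_mul_right (by linarith [h2, sq ‖k‖]) hkpos
  have h4 : ‖k‖ ^ 2 ≤ ‖hpKernel hz‖ ^ 2 * ‖T‖ ^ 2 := by
    rw [← mul_pow]; gcongr
  rw [hk2, norm_hpKernel_sq hz] at h4
  have h5 := mul_le_mul_of_nonneg_left h4 (by positivity : 0 ≤ 2 * z.re * (φ z).re)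
  have e1 : 2 * z.re * (φ z).re * (1 / (2 * (φ z).re)) = z.re := by field_simp
  have e2 : 2 * z.re * (φ z).re * (1 / (2 * z.re) * ‖T‖ ^ 2) = ‖T‖ ^ 2 * (φ z).re := by
    field_simp
  rwa [e1, e2] at h5

end Kernel

section SchwarzPick

theorem norm_add_conj_sq (z w : ℂ) :
    ‖z + conj w‖ ^ 2 = ‖z - w‖ ^ 2 + 4 * (z.re * w.re) := by
  simp only [← Complex.normSq_eq_norm_sq, Complex.normSq_apply]
  simp
  ring

theorem norm_sub_lt_norm_add_conj {z w : ℂ} (hz : z ∈ rightHP) (hw : w ∈ rightHP) :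
    ‖z - w‖ < ‖z + conj w‖ := by
  have h : 0 < z.re * w.re := mul_pos hz hw
  exact lt_of_pow_lt_pow_left₀ 2 (norm_nonneg _) (by rw [norm_add_conj_sq]; linarith)

theorem add_conj_ne_zero {z w : ℂ} (hz : z ∈ rightHP) (hw : w ∈ rightHP) : z + conj w ≠ 0 := by
  rw [← norm_pos_iff]
  exact (norm_nonneg _).trans_lt (norm_sub_lt_norm_add_conj hz hw)

/-- The Cayley-type map of the unit disc onto `ℂ₊` taking `0` to `w` sends the disc into `ℂ₊`. -/
theorem cayley_mem_rightHP {w ζ : ℂ} (hw : w ∈ rightHP) (hζ : ζ ∈ ball (0 : ℂ) 1) :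
    (w + conj w * ζ) / (1 - ζ) ∈ rightHP := by
  have hw' : 0 < w.re := hw
  have hζ' : ‖ζ‖ < 1 := by simpa using hζ
  have hne : 1 - ζ ≠ 0 := by
    intro h
    rw [← sub_eq_zero.1 h] at hζ'
    simp at hζ'
  have hsq : Complex.normSq ζ < 1 := by
    rw [Complex.normSq_eq_norm_sq]
    nlinarith [norm_nonneg ζ]
  have hpos : 0 < Complex.normSq (1 - ζ) := Complex.normSq_pos.2 hne
  change 0 < ((w + conj w * ζ) / (1 - ζ)).re
  rw [Complex.div_re, ← add_div]
  refine div_pos ?_ hpos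
  rw [Complex.normSq_apply] at hsq
  simp
  nlinarith

/-- The **Schwarz–Pick lemma** for the right half-plane. -/
theorem norm_sub_sq_mul_re_le_of_mapsTo_rightHP {f : ℂ → ℂ} (hd : DifferentiableOn ℂ f rightHP)
    (hf : MapsTo f rightHP rightHP) {z w : ℂ} (hz : z ∈ rightHP) (hw : w ∈ rightHP) :
    ‖f z - f w‖ ^ 2 * (z.re * w.re) ≤ ‖z - w‖ ^ 2 * ((f z).re * (f w).re) := by
  set ψ : ℂ → ℂ := fun ζ => (w + conj w * ζ) / (1 - ζ)
  set g : ℂ → ℂ := fun ζ => (f (ψ ζ) - f w) / (f (ψ ζ) + conj (f w))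
  have hψ : MapsTo ψ (ball 0 1) rightHP := fun ζ hζ => cayley_mem_rightHP hw hζ
  have hψd : DifferentiableOn ℂ ψ (ball 0 1) := by
    refine DifferentiableOn.div (by fun_prop) (by fun_prop) fun ζ hζ h => ?_
    rw [← sub_eq_zero.1 h] at hζ
    simp at hζ
  have hfψ : DifferentiableOn ℂ (fun ζ => f (ψ ζ)) (ball 0 1) := hd.comp hψd hψ
  have hgd : DifferentiableOn ℂ g (ball 0 1) :=
    (hfψ.sub_const _).div (hfψ.add_const _) fun ζ hζ => add_conj_ne_zero (hf (hψ hζ)) (hf hw)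
  have hgm : MapsTo g (ball 0 1) (closedBall 0 1) := fun ζ hζ => by
    rw [mem_closedBall_zero_iff, norm_div]
    exact div_le_one_of_le₀ (norm_sub_lt_norm_add_conj (hf (hψ hζ)) (hf hw)).le (norm_nonneg _)
  have hg0 : g 0 = 0 := by simp [g, ψ]
  have hzw := add_conj_ne_zero hz hw
  have hfzw := add_conj_ne_zero (hf hz) (hf hw)
  have hlt := norm_sub_lt_norm_add_conj hz hw
  have hζ : ‖(z - w) / (z + conj w)‖ < 1 := by
    rw [norm_div, div_lt_one (norm_pos_iff.2 hzw)]
    exact hlt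
  have hψζ : ψ ((z - w) / (z + conj w)) = z := by
    have hww := add_conj_ne_zero hw hw
    have : 1 - (z - w) / (z + conj w) = (w + conj w) / (z + conj w) := by
      field_simp
      ring
    simp only [ψ]
    rw [this]
    field_simp
    ring
  have hS := Complex.norm_le_norm_of_mapsTo_ball hgd hgm hg0 hζ
  simp only [g, hψζ, norm_div] at hS
  rw [div_le_div_iff₀ (norm_pos_iff.2 hfzw) (norm_pos_iff.2 hzw)] at hS
  have hS2 := pow_le_pow_left₀ (by positivity) hS 2
  rw [mul_pow, mul_pow, norm_add_conj_sq, norm_add_conj_sq] at hS2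
  linarith

end SchwarzPick

section Flow

theorem hasDerivAt_re_comp {f : ℝ → ℂ} {f' : ℂ} {t : ℝ} (h : HasDerivAt f f' t) :
    HasDerivAt (fun s => (f s).re) f'.re t :=
  Complex.reCLM.hasFDerivAt.comp_hasDerivAt t h

theorem hasDerivAt_im_comp {f : ℝ → ℂ} {f' : ℂ} {t : ℝ} (h : HasDerivAt f f' t) :
    HasDerivAt (fun s => (f s).im) f'.im t :=
  Complex.imCLM.hasFDerivAt.comp_hasDerivAt t h

theorem deriv_nonneg_of_nonneg_right {k : ℝ → ℝ} {k' : ℝ} (h : HasDerivAt k k' 0) (h0 : k 0 = 0)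
    (hk : ∀ t, 0 ≤ t → 0 ≤ k t) : 0 ≤ k' := by
  refine ge_of_tendsto h.tendsto_slope_zero_right ?_
  filter_upwards [self_mem_nhdsWithin] with t ht
  have ht' : 0 < t := ht
  simpa [h0] using mul_nonneg (inv_nonneg.2 ht'.le) (hk t ht'.le)

variable {G : ℂ → ℂ} {φ : ℝ → ℂ → ℂ}

/-- Automorphisms of `ℂ₊` preserve the hyperbolic distance; this is the infinitesimal form. -/
theorem generator_identity
    (hφ0 : ∀ z ∈ rightHP, φ 0 z = z)
    (hφgrp : ∀ s t : ℝ, ∀ z ∈ rightHP, φ (s + t) z = φ s (φ t z))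
    (hode : ∀ z ∈ rightHP, ∀ t : ℝ, HasDerivAt (fun s : ℝ => φ s z) (G (φ t z)) t)
    (hd : ∀ t, DifferentiableOn ℂ (φ t) rightHP) (hm : ∀ t, MapsTo (φ t) rightHP rightHP)
    {z w : ℂ} (hz : z ∈ rightHP) (hw : w ∈ rightHP) :
    2 * (((G z).re - (G w).re) * (z.re - w.re) + ((G z).im - (G w).im) * (z.im - w.im)) *
        (z.re * w.re) =
      ((z.re - w.re) ^ 2 + (z.im - w.im) ^ 2) * ((G z).re * w.re + z.re * (G w).re) := by
  have hinv : ∀ t z, z ∈ rightHP → φ (-t) (φ t z) = z := fun t z hz => by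
    rw [← hφgrp _ _ _ hz, neg_add_cancel, hφ0 z hz]
  have hsq : ∀ a b : ℂ, ‖a - b‖ ^ 2 = (a.re - b.re) ^ 2 + (a.im - b.im) ^ 2 := fun a b => by
    rw [← Complex.normSq_eq_norm_sq, Complex.normSq_apply, Complex.sub_re, Complex.sub_im]
    ring
  have heq : ∀ t : ℝ,
      (((φ t z).re - (φ t w).re) ^ 2 + ((φ t z).im - (φ t w).im) ^ 2) * (z.re * w.re) =
        ((z.re - w.re) ^ 2 + (z.im - w.im) ^ 2) * ((φ t z).re * (φ t w).re) := fun t => by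
    rw [← hsq, ← hsq]
    refine le_antisymm (norm_sub_sq_mul_re_le_of_mapsTo_rightHP (hd t) (hm t) hz hw) ?_
    have := norm_sub_sq_mul_re_le_of_mapsTo_rightHP (hd (-t)) (hm (-t)) (hm t hz) (hm t hw)
    rwa [hinv t z hz, hinv t w hw] at this
  have hz0 := hode z hz 0
  have hw0 := hode w hw 0
  rw [hφ0 z hz] at hz0
  rw [hφ0 w hw] at hw0
  have hzr := hasDerivAt_re_comp hz0
  have hzi := hasDerivAt_im_comp hz0
  have hwr := hasDerivAt_re_comp hw0
  have hwi := hasDerivAt_im_comp hw0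
  have h1 := (((hzr.sub hwr).pow 2).add ((hzi.sub hwi).pow 2)).mul_const (z.re * w.re)
  have h2 := (hzr.mul hwr).const_mul ((z.re - w.re) ^ 2 + (z.im - w.im) ^ 2)
  have h3 := h1.unique (h2.congr_of_eventuallyEq (Eventually.of_forall heq))
  simp only [Pi.sub_apply, hφ0 z hz, hφ0 w hw] at h3
  push_cast at h3
  linear_combination h3

theorem generator_re_lower_bound {w : ℝ}
    (hφ0 : ∀ z ∈ rightHP, φ 0 z = z)
    (hode : ∀ z ∈ rightHP, ∀ t : ℝ, HasDerivAt (fun s : ℝ => φ s z) (G (φ t z)) t)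
    (hm : ∀ t, MapsTo (φ t) rightHP rightHP)
    {T : ℝ → HP2 →L[ℂ] HP2} (hrep : ∀ t : ℝ, RepresentsCompHP (T t) (φ t))
    (hw : ∀ t : ℝ, 0 ≤ t → ‖T t‖ ≤ Real.exp (w * t)) {z : ℂ} (hz : z ∈ rightHP) :
    -(2 * w) * z.re ≤ (G z).re := by
  have hz0 := hode z hz 0
  rw [hφ0 z hz] at hz0
  have hE : HasDerivAt (fun t : ℝ => Real.exp (2 * w * t)) (2 * w) 0 := by
    simpa using ((hasDerivAt_id (0 : ℝ)).const_mul (2 * w)).exp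
  have h := (hE.mul (hasDerivAt_re_comp hz0)).sub_const z.re
  have := deriv_nonneg_of_nonneg_right h (by simp [hφ0 z hz]) fun t ht => by
    have hpos : 0 < (φ t z).re := hm t hz
    have h1 := (hrep t).re_le_norm_sq_mul_re hz
    have h2 : ‖T t‖ ^ 2 ≤ Real.exp (2 * w * t) := by
      calc ‖T t‖ ^ 2 ≤ Real.exp (w * t) ^ 2 := by gcongr; exact hw t ht
        _ = _ := by rw [← Real.exp_nat_mul]; congr 1; push_cast; ring
    have h3 := mul_le_mul_of_nonneg_right h2 hpos.le
    exact sub_nonneg.2 (h1.trans h3)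
  simp only [hφ0 z hz, mul_zero, Real.exp_zero, one_mul] at this
  linarith

/-- A solution of the infinitesimal isometry identity of `ℂ₊` whose real part is bounded below
by a multiple of `Re z` is affine. -/
theorem affine_of_generator_identity {c : ℝ}
    (hE : ∀ z ∈ rightHP, ∀ w ∈ rightHP,
      2 * (((G z).re - (G w).re) * (z.re - w.re) + ((G z).im - (G w).im) * (z.im - w.im)) *
        (z.re * w.re) =
      ((z.re - w.re) ^ 2 + (z.im - w.im) ^ 2) * ((G z).re * w.re + z.re * (G w).re))
    (hc : ∀ z ∈ rightHP, c * z.re ≤ (G z).re) :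
    ∃ p q : ℝ, ∀ z ∈ rightHP, G z = (p : ℂ) * z + (q : ℂ) * Complex.I := by
  set h : ℝ → ℝ := fun y => (G ⟨1, y⟩).re with hh
  set v : ℝ → ℝ := fun y => (G ⟨1, y⟩).im
  have mem1 : ∀ y : ℝ, (⟨1, y⟩ : ℂ) ∈ rightHP := fun y => one_pos (α := ℝ)
  have hU : ∀ x y : ℝ, 0 < x → (G ⟨x, y⟩).re = x * h y := fun x y hx => by
    rcases eq_or_ne x 1 with rfl | hx1
    · simp [hh]
    · have e := hE ⟨x, y⟩ hx ⟨1, y⟩ (mem1 y)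
      simp only [hh] at e ⊢
      have hne : (x - 1) * (x + 1) ≠ 0 := mul_ne_zero (sub_ne_zero.2 hx1) (by positivity)
      apply mul_left_cancel₀ hne
      linear_combination e
  have hv : ∀ y y' : ℝ, 2 * (v y - v y') = (y - y') * (h y + h y') := fun y y' => by
    rcases eq_or_ne y y' with rfl | hy
    · simp
    · have e := hE ⟨1, y⟩ (mem1 y) ⟨1, y'⟩ (mem1 y')
      simp only [h, v] at e ⊢
      apply mul_left_cancel₀ (sub_ne_zero.2 hy)
      linear_combination e
  have hlin : ∀ y : ℝ, h y = h 0 + (h 1 - h 0) * y := fun y => by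
    linear_combination hv y 1 + hv 1 0 + hv 0 y
  have hb : h 1 - h 0 = 0 := by
    by_contra hne
    have e1 := hlin ((c - 1 - h 0) / (h 1 - h 0))
    rw [mul_div_cancel₀ _ hne] at e1
    have e2 := hc _ (mem1 ((c - 1 - h 0) / (h 1 - h 0)))
    simp only [hh] at e1 e2
    linarith
  have hre : ∀ x y : ℝ, 0 < x → (G ⟨x, y⟩).re = h 0 * x := fun x y hx => by
    rw [hU x y hx, hlin y, hb]; ring
  have him_ne : ∀ x y : ℝ, 0 < x → y ≠ 0 → (G ⟨x, y⟩).im = h 0 * y + v 0 := fun x y hx hy => by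
    have e := hE ⟨x, y⟩ hx ⟨1, 0⟩ (mem1 0)
    simp only [hre x y hx, hre 1 0 one_pos] at e
    apply mul_left_cancel₀ (mul_ne_zero hy hx.ne')
    simp only [v]
    linear_combination e / 2
  have him : ∀ x y : ℝ, 0 < x → (G ⟨x, y⟩).im = h 0 * y + v 0 := fun x y hx => by
    rcases eq_or_ne y 0 with rfl | hy
    · have e := hE ⟨x, 0⟩ hx ⟨x, 1⟩ hx
      simp only [hre x _ hx, him_ne x 1 hx one_ne_zero] at e
      apply mul_left_cancel₀ (mul_ne_zero hx.ne' hx.ne')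
      linear_combination -e / 2
    · exact him_ne x y hx hy
  refine ⟨h 0, v 0, fun z hz => ?_⟩
  apply Complex.ext
  · simpa using hre z.re z.im hz
  · simpa using him z.re z.im hz

theorem flow_eq_of_affine_generator {p q : ℝ}
    (hφ0 : ∀ z ∈ rightHP, φ 0 z = z)
    (hode : ∀ z ∈ rightHP, ∀ t : ℝ, HasDerivAt (fun s : ℝ => φ s z) (G (φ t z)) t)
    (hm : ∀ t, MapsTo (φ t) rightHP rightHP)
    (hG : ∀ z ∈ rightHP, G z = (p : ℂ) * z + (q : ℂ) * Complex.I) (hp : p ≠ 0)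
    (t : ℝ) {z : ℂ} (hz : z ∈ rightHP) :
    φ t z = z * Complex.exp ((p : ℂ) * (t : ℂ)) +
      ((q : ℂ) * Complex.I / (p : ℂ)) * (Complex.exp ((p : ℂ) * (t : ℂ)) - 1) := by
  have hp' : (p : ℂ) ≠ 0 := by exact_mod_cast hp
  have hd : ∀ s : ℝ, HasDerivAt
      (fun s : ℝ => (φ s z + (q : ℂ) * Complex.I / p) * Complex.exp (-(p * (s : ℂ)))) 0 s := by
    intro s
    have h1 : HasDerivAt (fun s : ℝ => Complex.exp (-(p * (s : ℂ))))
        (Complex.exp (-(p * (s : ℂ))) * -(p * 1)) s :=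
      ((Complex.ofRealCLM.hasDerivAt (x := s)).const_mul (p : ℂ)).neg.cexp
    refine (((hode z hz s).add_const ((q : ℂ) * Complex.I / p)).mul h1).congr_deriv ?_
    rw [hG _ (hm s hz)]
    field_simp
    ring
  have hconst := is_const_of_deriv_eq_zero (fun s => (hd s).differentiableAt)
    (fun s => (hd s).deriv) t 0
  simp only [hφ0 z hz, Complex.ofReal_zero, mul_zero, neg_zero, Complex.exp_zero, mul_one,
    Complex.exp_neg] at hconst
  rw [← div_eq_mul_inv, div_eq_iff (Complex.exp_ne_zero _)] at hconst
  linear_combination hconst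

theorem flow_eq_of_const_generator {q : ℝ}
    (hφ0 : ∀ z ∈ rightHP, φ 0 z = z)
    (hode : ∀ z ∈ rightHP, ∀ t : ℝ, HasDerivAt (fun s : ℝ => φ s z) (G (φ t z)) t)
    (hm : ∀ t, MapsTo (φ t) rightHP rightHP)
    (hG : ∀ z ∈ rightHP, G z = (q : ℂ) * Complex.I) (t : ℝ) {z : ℂ} (hz : z ∈ rightHP) :
    φ t z = z + (q : ℂ) * Complex.I * (t : ℂ) := by
  have hd : ∀ s : ℝ, HasDerivAt (fun s : ℝ => φ s z - (q : ℂ) * Complex.I * s) 0 s := by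
    intro s
    have h1 : HasDerivAt (fun s : ℝ => (q : ℂ) * Complex.I * s) ((q : ℂ) * Complex.I * 1) s :=
      (Complex.ofRealCLM.hasDerivAt (x := s)).const_mul _
    refine ((hode z hz s).sub h1).congr_deriv ?_
    rw [hG _ (hm s hz)]
    ring
  have hconst := is_const_of_deriv_eq_zero (fun s => (hd s).differentiableAt)
    (fun s => (hd s).deriv) t 0
  simp only [hφ0 z hz, Complex.ofReal_zero, mul_zero, sub_zero] at hconst
  linear_combination hconst

end Flow

/-- If `A f = G f'` generates a quasicontractive `C₀`-group of
bounded composition operators on `H²(ℂ₊)`, then `G(z) = pz + iq` with `p, q` real,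
and the flow is `φ_t(z) = z e^{pt} + (iq/p)(e^{pt} - 1)` if `p ≠ 0`, and
`φ_t(z) = z + iqt` if `p = 0`. -/
theorem statement19 (G : ℂ → ℂ) (hG : DifferentiableOn ℂ G rightHP)
    (φ : ℝ → ℂ → ℂ)
    (hφ0 : ∀ z ∈ rightHP, φ 0 z = z)
    (hφgrp : ∀ s t : ℝ, ∀ z ∈ rightHP, φ (s + t) z = φ s (φ t z))
    (hode : ∀ z ∈ rightHP, ∀ t : ℝ, HasDerivAt (fun s : ℝ => φ s z) (G (φ t z)) t)
    (T : ℝ → HP2 →L[ℂ] HP2) (hT : IsC0Group T)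
    (hrep : ∀ t : ℝ, RepresentsCompHP (T t) (φ t))
    (hgen : IsGeneratorGrp T (domAhp G) (opAhp G))
    (hqc : Quasicontractive T ∧ Quasicontractive (fun t : ℝ => T (-t))) :
    ∃ p q : ℝ,
      (∀ z ∈ rightHP, G z = (p : ℂ) * z + (q : ℂ) * Complex.I) ∧
      (p ≠ 0 → ∀ t : ℝ, ∀ z ∈ rightHP,
        φ t z = z * Complex.exp ((p : ℂ) * (t : ℂ)) +
          ((q : ℂ) * Complex.I / (p : ℂ)) * (Complex.exp ((p : ℂ) * (t : ℂ)) - 1)) ∧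
      (p = 0 → ∀ t : ℝ, ∀ z ∈ rightHP,
        φ t z = z + (q : ℂ) * Complex.I * (t : ℂ)) := by
  have hd := fun t => (hrep t).1
  have hm := fun t => (hrep t).2.1
  obtain ⟨w, -, hw⟩ := hqc.1
  obtain ⟨p, q, hpq⟩ := affine_of_generator_identity
    (fun z hz w hw => generator_identity hφ0 hφgrp hode hd hm hz hw)
    (fun z hz => generator_re_lower_bound hφ0 hode hm hrep hw hz)
  refine ⟨p, q, hpq, fun hp t z hz => flow_eq_of_affine_generator hφ0 hode hm hpq hp t hz, ?_⟩
  rintro rfl t z hz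
  exact flow_eq_of_const_generator hφ0 hode hm (fun z hz => by simpa using hpq z hz) t hz
end
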